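/- Let (G, P, L) be a minimum counterexample to the following statement, minimizing |V(G)| + |E(G)| and then the sum of the list sizes: 'Every plane graph G with no 4-cycle, with outer face F, subpath P ⊆ F with at most three vertices, and (*,1)-list assignment L satisfying conditions (i)–(vi) is L-colorable.' If v0v1v2 is a path on the outer cycle F with |L(v1)| = 2, then L(v1) ∩ L(v0) ≠ L(v1) ∩ L(v2). -/

import Mathlib

open Set

namespace ChoosSep

/-- `G` has a cycle of length `n`. -/
def HasCycleLen {V : Type} (G : SimpleGraph V) (n : ℕ) : Prop :=
  ∃ (v : V) (c : G.Walk v v), c.IsCycle ∧ c.length = n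

/-- `G` has a proper coloring choosing each color from the list `L v`. -/
def ColorableWith {V : Type} (G : SimpleGraph V) (L : V → Finset ℕ) : Prop :=
  ∃ φ : V → ℕ, (∀ v, φ v ∈ L v) ∧ ∀ ⦃u v⦄, G.Adj u v → φ u ≠ φ v

/-- `G` is `(k,d)`-choosable: it has an `L`-coloring for every list assignment
giving each vertex at least `k` colors and any two adjacent vertices at most `d`
common colors. -/
def Choosable {V : Type} (G : SimpleGraph V) (k d : ℕ) : Prop :=
  ∀ L : V → Finset ℕ, (∀ v, k ≤ (L v).card) →
    (∀ ⦃u v⦄, G.Adj u v → ((L u) ∩ (L v)).card ≤ d) →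
    ColorableWith G L

/-- The closed straight segment between two points of the plane. -/
def seg (x y : ℝ × ℝ) : Set (ℝ × ℝ) := segment ℝ x y

/-- A straight-line plane embedding of `G`: vertices go to distinct points, edges are
drawn as straight segments, two distinct edges meet only in common endpoints, and no
vertex lies on the drawing of an edge it does not belong to.  By Fáry's theorem a
finite simple graph admits such an embedding iff it is planar. -/
structure PlaneEmb {V : Type} (G : SimpleGraph V) where
  pos : V → ℝ × ℝ
  inj : Function.Injective pos
  edges_meet : ∀ ⦃a b c d : V⦄, G.Adj a b → G.Adj c d → s(a, b) ≠ s(c, d) →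
    seg (pos a) (pos b) ∩ seg (pos c) (pos d) ⊆ ({pos a, pos b} ∩ {pos c, pos d} : Set (ℝ × ℝ))
  vertex_off : ∀ ⦃a b v : V⦄, G.Adj a b → v ≠ a → v ≠ b → pos v ∉ seg (pos a) (pos b)

/-- `G` is planar: it admits a plane embedding. -/
def IsPlanar {V : Type} (G : SimpleGraph V) : Prop := Nonempty (PlaneEmb G)

variable {V : Type} {G : SimpleGraph V}

/-- The drawing of the graph in the plane: all vertex points and all edge segments. -/
def PlaneEmb.drawing (E : PlaneEmb G) : Set (ℝ × ℝ) :=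
  Set.range E.pos ∪ ⋃ (a : V) (b : V) (_ : G.Adj a b), seg (E.pos a) (E.pos b)

/-- A face of the embedding: a connected component of the complement of the drawing. -/
def PlaneEmb.IsFace (E : PlaneEmb G) (C : Set (ℝ × ℝ)) : Prop :=
  ∃ q, q ∉ E.drawing ∧ C = connectedComponentIn E.drawingᶜ q

/-- The outer face: the unbounded face. -/
def PlaneEmb.IsOuterFace (E : PlaneEmb G) (C : Set (ℝ × ℝ)) : Prop :=
  E.IsFace C ∧ ¬ Bornology.IsBounded C

/-- The vertices lying on the boundary of the face `C`. -/
def PlaneEmb.onFace (E : PlaneEmb G) (C : Set (ℝ × ℝ)) : Set V :=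
  {v | E.pos v ∈ closure C}

/-- An edge of `G` lying on the boundary of the face `C`. -/
def PlaneEmb.BoundaryEdge (E : PlaneEmb G) (C : Set (ℝ × ℝ)) (u v : V) : Prop :=
  G.Adj u v ∧ seg (E.pos u) (E.pos v) ⊆ closure C

/-- `C` is a 3-face with (mutually adjacent) incident vertices `x`, `y`, `z`. -/
def PlaneEmb.IsTriFace (E : PlaneEmb G) (C : Set (ℝ × ℝ)) (x y z : V) : Prop :=
  E.IsFace C ∧ G.Adj x y ∧ G.Adj y z ∧ G.Adj x z ∧
    frontier C = seg (E.pos x) (E.pos y) ∪ seg (E.pos y) (E.pos z) ∪ seg (E.pos x) (E.pos z)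

/-- `C` is a 4-face with incident 4-cycle `w x y z`. -/
def PlaneEmb.IsQuadFace (E : PlaneEmb G) (C : Set (ℝ × ℝ)) (w x y z : V) : Prop :=
  E.IsFace C ∧ G.Adj w x ∧ G.Adj x y ∧ G.Adj y z ∧ G.Adj z w ∧ w ≠ y ∧ x ≠ z ∧
    frontier C = seg (E.pos w) (E.pos x) ∪ seg (E.pos x) (E.pos y) ∪
      seg (E.pos y) (E.pos z) ∪ seg (E.pos z) (E.pos w)

/-- `x z1 y z2` is a diamond: a 4-cycle formed by two adjacent 3-faces
`x y z1` and `x y z2` sharing the edge `x y`. -/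
def PlaneEmb.IsDiamond (E : PlaneEmb G) (x z1 y z2 : V) : Prop :=
  z1 ≠ z2 ∧ ∃ C1 C2 : Set (ℝ × ℝ), C1 ≠ C2 ∧ E.IsTriFace C1 x y z1 ∧ E.IsTriFace C2 x y z2

/-- The union of the three sides of the triangle `a b c`. -/
def triBoundary (a b c : ℝ × ℝ) : Set (ℝ × ℝ) := seg a b ∪ seg b c ∪ seg a c

/-- The open interior region of the triangle `a b c`: points off the triangle whose
connected component in the complement of the triangle is bounded. -/
def triInterior (a b c : ℝ × ℝ) : Set (ℝ × ℝ) :=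
  {p | p ∉ triBoundary a b c ∧
    Bornology.IsBounded (connectedComponentIn (triBoundary a b c)ᶜ p)}

/-- The degree of a vertex. -/
noncomputable def deg (G : SimpleGraph V) (v : V) : ℕ := Nat.card {u : V // G.Adj v u}

/-- `G` is 2-connected: connected and with no cutvertex. -/
def TwoConnected (G : SimpleGraph V) : Prop :=
  G.Connected ∧ ∀ v : V, (G.induce {u : V | u ≠ v}).Connected

/-- A configuration for Theorem 6: a plane graph with no 4-cycle, outer face `F`, a
precolored subpath `P` of the outer face with at most three vertices, and a
`(*,1)`-list assignment `L` satisfying conditions (i)–(vi). -/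
structure Cfg4 where
  n : ℕ
  G : SimpleGraph (Fin n)
  E : PlaneEmb G
  F : Set (ℝ × ℝ)
  P : List (Fin n)
  L : Fin n → Finset ℕ

namespace Cfg4

/-- All hypotheses of Theorem 6 hold for the configuration. -/
def Valid (C : Cfg4) : Prop :=
  (¬ HasCycleLen C.G 4) ∧
  C.E.IsOuterFace C.F ∧
  C.P.Nodup ∧ C.P.length ≤ 3 ∧
  (∀ v ∈ C.P, v ∈ C.E.onFace C.F) ∧
  C.P.Chain' (C.E.BoundaryEdge C.F) ∧
  (∀ v, 1 ≤ (C.L v).card) ∧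
  (∀ ⦃u v⦄, C.G.Adj u v → ((C.L u) ∩ (C.L v)).card ≤ 1) ∧
  (∀ v, v ∉ C.E.onFace C.F → 3 ≤ (C.L v).card) ∧
  (∀ v ∈ C.E.onFace C.F, v ∉ C.P → 2 ≤ (C.L v).card) ∧
  (∀ v ∈ C.P, (C.L v).card = 1) ∧
  (∀ ⦃u v⦄, C.G.Adj u v → (C.L u).card = 2 → (C.L v).card ≠ 2) ∧
  (∃ φ : Fin C.n → ℕ, (∀ v ∈ C.P, φ v ∈ C.L v) ∧
    ∀ ⦃u v⦄, u ∈ C.P → v ∈ C.P → C.G.Adj u v → φ u ≠ φ v) ∧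
  (∀ x, (C.L x).card = 2 → ∀ u ∈ C.P, ∀ v ∈ C.P, u ≠ v →
    C.G.Adj x u → C.G.Adj x v → False)

/-- The configuration admits an `L`-coloring. -/
def Colorable (C : Cfg4) : Prop := ColorableWith C.G C.L

/-- The quantity `|V(G)| + |E(G)|`. -/
noncomputable def measure (C : Cfg4) : ℕ := C.n + Nat.card ↥C.G.edgeSet

/-- The sum of the sizes of the lists. -/
def listSum (C : Cfg4) : ℕ := ∑ v, (C.L v).card

/-- `C` is a minimum counterexample to Theorem 6: it satisfies the hypotheses, has no
`L`-coloring, and minimizes `|V(G)| + |E(G)|` and then the sum of the list sizes among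
all such counterexamples. -/
def MinCounterexample (C : Cfg4) : Prop :=
  C.Valid ∧ ¬ C.Colorable ∧
    ∀ D : Cfg4, D.Valid → ¬ D.Colorable →
      C.measure ≤ D.measure ∧ (D.measure = C.measure → C.listSum ≤ D.listSum)

/-- `uv` is a chord of the outer cycle: an edge between two vertices of the outer
face that is not an edge of the outer face. -/
def IsChord (C : Cfg4) (u v : Fin C.n) : Prop :=
  C.G.Adj u v ∧ u ∈ C.E.onFace C.F ∧ v ∈ C.E.onFace C.F ∧ ¬ C.E.BoundaryEdge C.F u v

/-- A chord `uv` is bad if one of its `Q`-components is a triangle `u v x` with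
`|L(x)| = 2`: i.e. there is an `L2`-vertex `x` with `ux` and `xv` edges of the outer
cycle such that the triangle `u x v` encloses no vertex of `G`. -/
def IsBadChord (C : Cfg4) (u v : Fin C.n) : Prop :=
  C.IsChord u v ∧ ∃ x : Fin C.n, (C.L x).card = 2 ∧
    C.G.Adj u x ∧ C.G.Adj x v ∧
    C.E.BoundaryEdge C.F u x ∧ C.E.BoundaryEdge C.F x v ∧
    ∀ w : Fin C.n, C.E.pos w ∉ triInterior (C.E.pos u) (C.E.pos x) (C.E.pos v)

/-- `v0 v1 v2` is a 2-chord of the outer cycle. -/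
def Is2Chord (C : Cfg4) (v0 v1 v2 : Fin C.n) : Prop :=
  C.G.Adj v0 v1 ∧ C.G.Adj v1 v2 ∧ v0 ≠ v2 ∧
    v0 ∈ C.E.onFace C.F ∧ v2 ∈ C.E.onFace C.F ∧ v1 ∉ C.E.onFace C.F

/-- A 2-chord `v0 v1 v2` is separating if `v0 v2` is not an edge of the outer cycle. -/
def IsSep2Chord (C : Cfg4) (v0 v1 v2 : Fin C.n) : Prop :=
  C.Is2Chord v0 v1 v2 ∧ ¬ C.E.BoundaryEdge C.F v0 v2

/-- `v` is a middle vertex: it has degree two in the path `P`. -/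
def IsMiddle (C : Cfg4) (v : Fin C.n) : Prop :=
  ∃ a b, C.P = [a, v, b]

/-- `v0 v1 v2` is a path on the outer cycle `F`. -/
def IsOuterPath (C : Cfg4) (v0 v1 v2 : Fin C.n) : Prop :=
  v0 ≠ v2 ∧ C.E.BoundaryEdge C.F v0 v1 ∧ C.E.BoundaryEdge C.F v1 v2

end Cfg4

/-- A continuous determination, off `K`, of the angle under which a path from `a` to `b`
running inside `K` is seen. -/
def HasAngleLift (K : Set ℂ) (a b : ℂ) : Prop :=
  ∃ Θ : ℂ → ℝ, ContinuousOn Θ Kᶜ ∧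
    ∀ z ∉ K, ∃ r : ℝ, 0 < r ∧ b - z = r * Complex.exp (Θ z * Complex.I) * (a - z)

/-- The point near the segment from `a` to `b`, at fraction `ε` of its length and shifted by
`δ` times its length to the left. -/
noncomputable def sidePt (a b : ℂ) (ε δ : ℝ) : ℂ := a + (ε + δ * Complex.I) * (b - a)

lemma sidePt_symm (a b : ℂ) (ε δ : ℝ) : sidePt b a (1 - ε) (-δ) = sidePt a b ε δ := by
  simp only [sidePt]; push_cast; ring

lemma continuous_sidePt (a b : ℂ) (ε : ℝ) : Continuous (sidePt a b ε) := by
  unfold sidePt; fun_prop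

lemma segment_eq_sidePt (a b : ℂ) :
    segment ℝ a b = (fun t : ℝ => sidePt a b t 0) '' Icc 0 1 := by
  rw [segment_eq_image']
  refine image_congr fun t _ => ?_
  simp [sidePt]

lemma isCompact_segment (a b : ℂ) : IsCompact (segment ℝ a b) := by
  rw [segment_eq_sidePt]
  refine isCompact_Icc.image ?_
  unfold sidePt; fun_prop

lemma div_mem_slitPlane_of_notMem_segment {a b z : ℂ} (hz : z ∉ segment ℝ a b) :
    (b - z) / (a - z) ∈ Complex.slitPlane := by
  by_contra h
  have haz : a - z ≠ 0 := by
    intro h0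
    rw [sub_eq_zero] at h0
    exact hz (h0 ▸ left_mem_segment ℝ a b)
  set w := (b - z) / (a - z) with hw
  rw [Complex.mem_slitPlane_iff, not_or, not_lt, not_not] at h
  have hw' : w = ((w.re : ℝ) : ℂ) := by
    apply Complex.ext <;> simp [h.2]
  have hb : b - z = (w.re : ℂ) * (a - z) := by
    rw [← hw', hw, div_mul_cancel₀ _ haz]
  have hpos : 0 < 1 - w.re := by linarith [h.1]
  have hne : ((1 - w.re : ℝ) : ℂ) ≠ 0 := by exact_mod_cast hpos.ne'
  apply hz
  refine ⟨-w.re / (1 - w.re), 1 / (1 - w.re), div_nonneg (by linarith [h.1]) hpos.le,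
    by positivity, by field_simp; ring, ?_⟩
  have hz' : z * ((1 - w.re : ℝ) : ℂ) = b - w.re * a := by
    push_cast; linear_combination (-1 : ℂ) * hb
  rw [Complex.real_smul, Complex.real_smul]
  push_cast at hne hz' ⊢
  field_simp
  linear_combination -hz'

lemma left_sub_ne_zero_of_notMem_segment {a b z : ℂ} (hz : z ∉ segment ℝ a b) : a - z ≠ 0 := by
  intro h0
  rw [sub_eq_zero] at h0
  exact hz (h0 ▸ left_mem_segment ℝ a b)

lemma continuousOn_arg_div (a b : ℂ) :
    ContinuousOn (fun z => ((b - z) / (a - z)).arg) (segment ℝ a b)ᶜ := by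
  intro z hz
  have : ContinuousAt (fun z => (b - z) / (a - z)) z := by
    refine ContinuousAt.div ?_ ?_ (left_sub_ne_zero_of_notMem_segment hz) <;> fun_prop
  exact ((Complex.continuousAt_arg (div_mem_slitPlane_of_notMem_segment hz)).comp
    (f := fun z => (b - z) / (a - z)) this).continuousWithinAt

lemma exp_arg_div {a b z : ℂ} (hz : z ∉ segment ℝ a b) : ∃ r : ℝ, 0 < r ∧
    b - z = r * Complex.exp ((((b - z) / (a - z)).arg : ℝ) * Complex.I) * (a - z) := by
  refine ⟨‖(b - z) / (a - z)‖,
    norm_pos_iff.2 (Complex.slitPlane_ne_zero (div_mem_slitPlane_of_notMem_segment hz)), ?_⟩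
  rw [Complex.norm_mul_exp_arg_mul_I, div_mul_cancel₀ _ (left_sub_ne_zero_of_notMem_segment hz)]

lemma hasAngleLift_segment (a b : ℂ) : HasAngleLift (segment ℝ a b) a b :=
  ⟨_, continuousOn_arg_div a b, fun _ hz => exp_arg_div hz⟩

lemma HasAngleLift.trans {K K' : Set ℂ} {a b c : ℂ} (h : HasAngleLift K a b)
    (h' : HasAngleLift K' b c) : HasAngleLift (K ∪ K') a c := by
  obtain ⟨Θ, hc, hΘ⟩ := h
  obtain ⟨Θ', hc', hΘ'⟩ := h'
  refine ⟨fun z => Θ z + Θ' z, ?_, ?_⟩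
  · exact (hc.mono (compl_subset_compl.2 subset_union_left)).add
      (hc'.mono (compl_subset_compl.2 subset_union_right))
  · intro z hz
    rw [mem_union, not_or] at hz
    obtain ⟨r, hr, h1⟩ := hΘ z hz.1
    obtain ⟨r', hr', h2⟩ := hΘ' z hz.2
    refine ⟨r' * r, by positivity, ?_⟩
    rw [h2, h1]
    push_cast
    rw [add_mul, Complex.exp_add]
    ring

lemma exists_hasAngleLift {F : Set ℂ} (hF : IsOpen F) (hF' : IsPreconnected F) {a b : ℂ}
    (ha : a ∈ F) (hb : b ∈ F) : ∃ K ⊆ F, IsCompact K ∧ a ∈ K ∧ HasAngleLift K a b := by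
  refine hF'.induction₂' (fun x y => ∃ K ⊆ F, IsCompact K ∧ x ∈ K ∧ HasAngleLift K x y)
    ?_ ?_ ha hb
  · intro x hx
    obtain ⟨r, hr, hball⟩ := Metric.isOpen_iff.1 hF x hx
    filter_upwards [mem_nhdsWithin_of_mem_nhds (Metric.ball_mem_nhds x hr)] with y hy
    have hsub : segment ℝ x y ⊆ F :=
      ((convex_ball x r).segment_subset (Metric.mem_ball_self hr) hy).trans hball
    refine ⟨⟨_, hsub, isCompact_segment x y, left_mem_segment ℝ x y,
      hasAngleLift_segment x y⟩, _, ?_, isCompact_segment y x, left_mem_segment ℝ y x,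
      hasAngleLift_segment y x⟩
    rwa [segment_symm]
  · rintro x y z - - - ⟨K, hK, hKc, hx, hl⟩ ⟨K', hK', hKc', -, hl'⟩
    exact ⟨K ∪ K', union_subset hK hK', hKc.union hKc', Or.inl hx, hl.trans hl'⟩

open Filter Topology in
/-- The two sides of a segment of a closed curve lie in different components of its complement. -/
theorem sides_separated {K T : Set ℂ} {a v : ℂ} {ε : ℝ} (hK : IsClosed K)
    (hl : HasAngleLift K a v) (hav : a ≠ v) (hε0 : 0 < ε) (hε1 : ε < 1)
    (hm : sidePt v a ε 0 ∉ K) (hT : IsPreconnected T) (hTK : Disjoint T (K ∪ segment ℝ v a))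
    (hpos : ∀ᶠ δ in 𝓝[>] (0 : ℝ), sidePt v a ε δ ∈ T)
    (hneg : ∀ᶠ δ in 𝓝[<] (0 : ℝ), sidePt v a ε δ ∈ T) : False := by
  have hd : a - v ≠ 0 := sub_ne_zero.2 hav
  obtain ⟨Θ, hΘc, hΘ⟩ := hl
  set W : ℂ → ℝ := fun z => ((a - z) / (v - z)).arg + Θ z with hW
  rw [disjoint_union_right] at hTK
  have hWc : ContinuousOn W T :=
    ((continuousOn_arg_div v a).mono hTK.2.subset_compl_right).add
      (hΘc.mono hTK.1.subset_compl_right)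
  have hWint : MapsTo W T (range fun k : ℤ => (k : ℝ) * (2 * Real.pi)) := by
    intro z hz
    have hzv := left_sub_ne_zero_of_notMem_segment (disjoint_left.1 hTK.2 hz)
    obtain ⟨r, hr, h1⟩ := exp_arg_div (disjoint_left.1 hTK.2 hz)
    obtain ⟨r', hr', h2⟩ := hΘ z (disjoint_left.1 hTK.1 hz)
    have h3 : (r' * r : ℝ) * Complex.exp (W z * Complex.I) = 1 := by
      apply mul_right_cancel₀ hzv
      simp only [hW]
      push_cast
      rw [one_mul, add_mul, Complex.exp_add]
      linear_combination (-1 : ℂ) * h2 - (r' * Complex.exp (Θ z * Complex.I)) * h1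
    have h4 : r' * r = 1 := by
      have := congrArg norm h3
      rwa [norm_mul, Complex.norm_exp_ofReal_mul_I, Complex.norm_real, mul_one, norm_one,
        Real.norm_of_nonneg (by positivity)] at this
    rw [h4, Complex.ofReal_one, one_mul, Complex.exp_eq_one_iff] at h3
    obtain ⟨k, hk⟩ := h3
    refine ⟨k, ?_⟩
    have : (W z : ℂ) = ((k * (2 * Real.pi) : ℝ) : ℂ) := by
      apply mul_right_cancel₀ Complex.I_ne_zero
      rw [hk]; push_cast; ring
    exact_mod_cast this.symm
  have hdisc : IsDiscrete (range fun k : ℤ => (k : ℝ) * (2 * Real.pi)) := by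
    have : (range fun k : ℤ => (k : ℝ) * (2 * Real.pi)) =
        (AddSubgroup.zmultiples (2 * Real.pi) : Set ℝ) := by
      ext x
      simp [AddSubgroup.mem_zmultiples_iff]
    rw [this]
    exact ⟨inferInstanceAs (DiscreteTopology (AddSubgroup.zmultiples (2 * Real.pi)))⟩
  have hconst : ∀ z ∈ T, ∀ z' ∈ T, W z = W z' := fun z hz z' hz' =>
    hT.constant_of_mapsTo hdisc hWc hWint hz hz'
  have hside : Tendsto (fun δ => sidePt v a ε δ) (𝓝 0) (𝓝 (sidePt v a ε 0)) :=
    (continuous_sidePt v a ε).tendsto 0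
  have hΘlim : Tendsto (fun δ => Θ (sidePt v a ε δ)) (𝓝 0) (𝓝 (Θ (sidePt v a ε 0))) :=
    ((hΘc.continuousAt (hK.isOpen_compl.mem_nhds hm)).tendsto).comp hside
  have hquot : ∀ δ : ℝ, (a - sidePt v a ε δ) / (v - sidePt v a ε δ) =
      (1 - ε - δ * Complex.I) / (-ε - δ * Complex.I) := by
    intro δ
    have h1 : a - sidePt v a ε δ = (1 - ε - δ * Complex.I) * (a - v) := by
      simp only [sidePt]; ring
    have h2 : v - sidePt v a ε δ = (-ε - δ * Complex.I) * (a - v) := by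
      simp only [sidePt]; ring
    rw [h1, h2, mul_div_mul_right _ _ hd]
  have hq0 : ∀ δ : ℝ, (-ε - δ * Complex.I : ℂ) ≠ 0 := by
    intro δ h
    have := congrArg Complex.re h
    simp at this
    exact hε0.ne' this
  have hqlim : Tendsto (fun δ : ℝ => (1 - ε - δ * Complex.I : ℂ) / (-ε - δ * Complex.I)) (𝓝 0)
      (𝓝 ((1 - ε - (0 : ℝ) * Complex.I) / (-ε - (0 : ℝ) * Complex.I))) := by
    refine ContinuousAt.tendsto (f := fun δ : ℝ =>
      (1 - ε - δ * Complex.I : ℂ) / (-ε - δ * Complex.I)) (x := 0) ?_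
    refine ContinuousAt.div ?_ ?_ (hq0 0) <;> fun_prop
  have hq0' : ((1 - ε - (0 : ℝ) * Complex.I) / (-ε - (0 : ℝ) * Complex.I) : ℂ) =
      ((-(1 - ε) / ε : ℝ) : ℂ) := by
    push_cast
    have : (ε : ℂ) ≠ 0 := by exact_mod_cast hε0.ne'
    rw [div_eq_div_iff (by simpa using this) this]
    ring
  have him : ∀ δ : ℝ, ((1 - ε - δ * Complex.I : ℂ) / (-ε - δ * Complex.I)).im =
      δ / Complex.normSq (-ε - δ * Complex.I) := by
    intro δ
    rw [Complex.div_im]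
    simp
    ring
  have hre : ((-(1 - ε) / ε : ℝ) : ℂ).re < 0 := by
    rw [Complex.ofReal_re]
    exact div_neg_of_neg_of_pos (by linarith) hε0
  have hnsq : ∀ δ : ℝ, 0 < Complex.normSq (-ε - δ * Complex.I) := fun δ =>
    Complex.normSq_pos.2 (hq0 δ)
  rw [hq0'] at hqlim
  have hlimpos : Tendsto (fun δ => W (sidePt v a ε δ)) (𝓝[>] 0)
      (𝓝 (Real.pi + Θ (sidePt v a ε 0))) := by
    refine Tendsto.add ?_ (hΘlim.mono_left nhdsWithin_le_nhds)
    simp_rw [hquot]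
    have h1 := Complex.tendsto_arg_nhdsWithin_im_nonneg_of_re_neg_of_im_zero hre
      (Complex.ofReal_im _)
    refine h1.comp (tendsto_nhdsWithin_iff.2 ⟨hqlim.mono_left nhdsWithin_le_nhds, ?_⟩)
    filter_upwards [self_mem_nhdsWithin] with δ hδ
    refine (him δ).symm ▸ ?_
    exact (div_pos hδ (hnsq δ)).le
  have hlimneg : Tendsto (fun δ => W (sidePt v a ε δ)) (𝓝[<] 0)
      (𝓝 (-Real.pi + Θ (sidePt v a ε 0))) := by
    refine Tendsto.add ?_ (hΘlim.mono_left nhdsWithin_le_nhds)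
    simp_rw [hquot]
    have h1 := Complex.tendsto_arg_nhdsWithin_im_neg_of_re_neg_of_im_zero hre
      (Complex.ofReal_im _)
    refine h1.comp (tendsto_nhdsWithin_iff.2 ⟨hqlim.mono_left nhdsWithin_le_nhds, ?_⟩)
    filter_upwards [self_mem_nhdsWithin] with δ hδ
    refine (him δ).symm ▸ ?_
    exact div_neg_of_neg_of_pos hδ (hnsq δ)
  obtain ⟨δ₀, hδ₀⟩ := hpos.exists
  have e1 := tendsto_nhds_unique hlimpos (tendsto_const_nhds.congr'
    (hpos.mono fun δ hδ => hconst _ hδ₀ _ hδ))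
  have e2 := tendsto_nhds_unique hlimneg (tendsto_const_nhds.congr'
    (hneg.mono fun δ hδ => hconst _ hδ₀ _ hδ))
  linarith [Real.pi_pos]

open Filter Topology in
/-- A thin connected strip along the left side of a segment whose interior avoids `K`. -/
theorem exists_strip {a b : ℂ} (hab : a ≠ b) {K : Set ℂ} (hK : IsClosed K) (hne : K.Nonempty)
    (h : ∀ ε ∈ Ioo (0 : ℝ) 1, sidePt a b ε 0 ∉ K) :
    ∃ N, IsPreconnected N ∧ Disjoint N K ∧ Disjoint N (segment ℝ a b) ∧
      segment ℝ a b ⊆ closure N ∧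
      ∀ ε ∈ Ioo (0 : ℝ) 1, ∀ᶠ δ in 𝓝[>] (0 : ℝ), sidePt a b ε δ ∈ N := by
  have hd : 0 < ‖b - a‖ := norm_pos_iff.2 (sub_ne_zero.2 hab.symm)
  have hd' : b - a ≠ 0 := sub_ne_zero.2 hab.symm
  obtain ⟨d, hdef⟩ : ∃ d : ℝ → ℝ, ∀ ε, d ε = Metric.infDist (sidePt a b ε 0) K / ‖b - a‖ :=
    ⟨_, fun _ => rfl⟩
  have hdc : Continuous d := by
    have : d = fun ε => Metric.infDist (sidePt a b ε 0) K / ‖b - a‖ := funext hdef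
    rw [this]
    refine Continuous.div_const ((Metric.continuous_infDist_pt K).comp ?_) _
    unfold sidePt; fun_prop
  have hdpos : ∀ ε ∈ Ioo (0 : ℝ) 1, 0 < d ε := fun ε hε => by
    rw [hdef]
    exact div_pos ((hK.notMem_iff_infDist_pos hne).1 (h ε hε)) hd
  have hmem : ∀ ε ∈ Ioo (0 : ℝ) 1, ∀ δ, 0 < δ → δ < d ε →
      sidePt a b ε δ ∈ (fun p : ℝ × ℝ => sidePt a b p.1 (p.2 * d p.1)) ''
        (Ioo 0 1 ×ˢ Ioo 0 1) := by
    intro ε hε δ h0 h1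
    refine ⟨(ε, δ / d ε), ⟨hε, div_pos h0 (hdpos ε hε), (div_lt_one (hdpos ε hε)).2 h1⟩, ?_⟩
    simp only
    rw [div_mul_cancel₀ _ (hdpos ε hε).ne']
  have hev : ∀ ε ∈ Ioo (0 : ℝ) 1, ∀ᶠ δ in 𝓝[>] (0 : ℝ), sidePt a b ε δ ∈
      (fun p : ℝ × ℝ => sidePt a b p.1 (p.2 * d p.1)) '' (Ioo 0 1 ×ˢ Ioo 0 1) := by
    intro ε hε
    filter_upwards [Ioo_mem_nhdsGT (hdpos ε hε)] with δ hδ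
    exact hmem ε hε δ hδ.1 hδ.2
  refine ⟨(fun p : ℝ × ℝ => sidePt a b p.1 (p.2 * d p.1)) '' (Ioo 0 1 ×ˢ Ioo 0 1),
    ?_, ?_, ?_, ?_, hev⟩
  · refine (isPreconnected_Ioo.prod isPreconnected_Ioo).image _ ?_
    unfold sidePt
    have := hdc.comp continuous_fst (X := ℝ × ℝ)
    refine Continuous.continuousOn ?_
    fun_prop
  · rw [disjoint_left]
    rintro _ ⟨⟨ε, τ⟩, ⟨hε, hτ⟩, rfl⟩ hz
    have h1 := Metric.infDist_le_dist_of_mem (x := sidePt a b ε 0) hz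
    have h2 : dist (sidePt a b ε 0) (sidePt a b ε (τ * d ε)) = τ * d ε * ‖b - a‖ := by
      have h3 : sidePt a b ε 0 - sidePt a b ε (τ * d ε) =
          -(((τ * d ε : ℝ) : ℂ) * Complex.I * (b - a)) := by
        simp only [sidePt]; push_cast; ring
      rw [dist_eq_norm, h3, norm_neg, norm_mul, norm_mul, Complex.norm_I, Complex.norm_real,
        Real.norm_of_nonneg (mul_nonneg hτ.1.le (hdpos ε hε).le), mul_one]
    have h4 : Metric.infDist (sidePt a b ε 0) K = d ε * ‖b - a‖ := by
      rw [hdef]; field_simp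
    simp only at h1
    rw [h2, h4] at h1
    have := mul_pos (hdpos ε hε) hd
    nlinarith [hτ.2]
  · rw [disjoint_left, segment_eq_sidePt]
    rintro _ ⟨⟨ε, τ⟩, ⟨hε, hτ⟩, rfl⟩ ⟨t, -, ht⟩
    simp only [sidePt] at ht
    have h1 := mul_right_cancel₀ hd' (add_left_cancel ht)
    have h2 := congrArg Complex.im h1
    simp at h2
    rcases h2 with h2 | h2
    · exact hτ.1.ne' h2
    · exact (hdpos ε hε).ne' h2
  · have hcl : ∀ ε ∈ Ioo (0 : ℝ) 1, sidePt a b ε 0 ∈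
        closure ((fun p : ℝ × ℝ => sidePt a b p.1 (p.2 * d p.1)) '' (Ioo 0 1 ×ˢ Ioo 0 1)) := by
      intro ε hε
      exact mem_closure_of_tendsto
        (((continuous_sidePt a b ε).tendsto 0).mono_left nhdsWithin_le_nhds) (hev ε hε)
    rw [segment_eq_sidePt, ← closure_Ioo (zero_ne_one (α := ℝ))]
    refine (image_closure_subset_closure_image ?_).trans (closure_minimal ?_ isClosed_closure)
    · unfold sidePt; fun_prop
    · rintro _ ⟨ε, hε, rfl⟩
      exact hcl ε hε

/-- The point at polar coordinates `(ρ, γ)` around `v`, the unit vector being `a - v`. -/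
noncomputable def polarPt (v a : ℂ) (ρ γ : ℝ) : ℂ :=
  v + ρ * Complex.exp (γ * Complex.I) * (a - v)

lemma polarPt_zero_angle (v a : ℂ) (ρ : ℝ) : polarPt v a ρ 0 = sidePt v a ρ 0 := by
  simp [polarPt, sidePt]

lemma polarPt_polarPt (v a : ℂ) (ρ γ ρ' γ' : ℝ) :
    polarPt v (polarPt v a ρ γ) ρ' γ' = polarPt v a (ρ' * ρ) (γ' + γ) := by
  simp only [polarPt]
  push_cast
  rw [add_mul, Complex.exp_add]
  ring

lemma polarPt_two_pi (v a : ℂ) (ρ γ : ℝ) :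
    polarPt v a ρ (γ + 2 * Real.pi) = polarPt v a ρ γ := by
  simp only [polarPt]
  push_cast
  rw [add_mul, Complex.exp_add, Complex.exp_two_pi_mul_I, mul_one]

lemma polarPt_notMem_segment {v a : ℂ} (hav : a ≠ v) {ρ γ : ℝ} (hρ : 0 < ρ) (hγ0 : γ ≠ 0)
    (hγ : |γ| < 2 * Real.pi) : polarPt v a ρ γ ∉ segment ℝ v a := by
  rw [segment_eq_sidePt]
  rintro ⟨t, ht, h⟩
  simp only [sidePt, polarPt, Complex.ofReal_zero, zero_mul, add_zero] at h
  have h1 := mul_right_cancel₀ (sub_ne_zero.2 hav) (add_left_cancel h)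
  have h2 := congrArg norm h1
  rw [norm_mul, Complex.norm_exp_ofReal_mul_I, Complex.norm_real, Complex.norm_real, mul_one,
    Real.norm_of_nonneg hρ.le, Real.norm_of_nonneg ht.1] at h2
  have hρ' : (ρ : ℂ) ≠ 0 := by exact_mod_cast hρ.ne'
  rw [h2] at h1
  have h3 : Complex.exp (γ * Complex.I) = 1 := by
    apply mul_left_cancel₀ hρ'
    rw [mul_one]; exact h1.symm
  obtain ⟨n, hn⟩ := Complex.exp_eq_one_iff.1 h3
  have h4 : γ = n * (2 * Real.pi) := by
    have : (γ : ℂ) = ((n * (2 * Real.pi) : ℝ) : ℂ) := by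
      apply mul_right_cancel₀ Complex.I_ne_zero
      rw [hn]; push_cast; ring
    exact_mod_cast this
  have hn0 : n ≠ 0 := by
    rintro rfl
    exact hγ0 (by simpa using h4)
  have h5 : (1 : ℝ) ≤ |(n : ℝ)| := by exact_mod_cast Int.one_le_abs hn0
  rw [h4, abs_mul, abs_of_pos Real.two_pi_pos] at hγ
  nlinarith [Real.two_pi_pos]

/-- A small open sector at `v` is a connected set avoiding both of its sides. -/
theorem exists_sector {v a : ℂ} (hav : a ≠ v) {β R : ℝ} (hβ : β < 2 * Real.pi) (hR : 0 < R)
    {K : Set ℂ} (hK : IsClosed K) (hv : v ∉ K) :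
    ∃ N, IsPreconnected N ∧ Disjoint N K ∧ Disjoint N (segment ℝ v a) ∧
      Disjoint N (segment ℝ v (polarPt v a R β)) ∧
      ∃ r > 0, ∀ ρ ∈ Ioo 0 r, ∀ γ ∈ Ioo 0 β, polarPt v a ρ γ ∈ N := by
  obtain ⟨s, hs, hball⟩ := Metric.isOpen_iff.1 hK.isOpen_compl v hv
  have hd : 0 < ‖a - v‖ := norm_pos_iff.2 (sub_ne_zero.2 hav)
  refine ⟨(fun p : ℝ × ℝ => polarPt v a p.1 p.2) '' (Ioo 0 (s / ‖a - v‖) ×ˢ Ioo 0 β),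
    ?_, ?_, ?_, ?_, s / ‖a - v‖, by positivity, fun ρ hρ γ hγ => ⟨(ρ, γ), ⟨hρ, hγ⟩, rfl⟩⟩
  · refine (isPreconnected_Ioo.prod isPreconnected_Ioo).image _ ?_
    unfold polarPt
    refine Continuous.continuousOn ?_
    fun_prop
  · rw [disjoint_left]
    rintro _ ⟨⟨ρ, γ⟩, ⟨hρ, hγ⟩, rfl⟩ hz
    refine hball ?_ hz
    rw [Metric.mem_ball, dist_eq_norm]
    simp only [polarPt]
    rw [add_sub_cancel_left, norm_mul, norm_mul, Complex.norm_exp_ofReal_mul_I, mul_one,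
      Complex.norm_real, Real.norm_of_nonneg hρ.1.le]
    exact (lt_div_iff₀ hd).1 hρ.2
  · rw [disjoint_left]
    rintro _ ⟨⟨ρ, γ⟩, ⟨hρ, hγ⟩, rfl⟩
    exact polarPt_notMem_segment hav hρ.1 hγ.1.ne' (by
      rw [abs_of_pos hγ.1]; exact hγ.2.trans hβ)
  · rw [disjoint_left]
    rintro _ ⟨⟨ρ, γ⟩, ⟨hρ, hγ⟩, rfl⟩
    have h1 : polarPt v a ρ γ = polarPt v (polarPt v a R β) (ρ / R) (γ - β) := by
      rw [polarPt_polarPt, div_mul_cancel₀ _ hR.ne', sub_add_cancel]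
    have h2 : polarPt v a R β ≠ v := by
      simp only [polarPt, ne_eq, add_eq_left, mul_eq_zero, not_or, Complex.ofReal_eq_zero]
      exact ⟨⟨hR.ne', Complex.exp_ne_zero _⟩, sub_ne_zero.2 hav⟩
    simp only
    rw [h1]
    refine polarPt_notMem_segment h2 (div_pos hρ.1 hR) (sub_neg.2 hγ.2).ne ?_
    rw [abs_of_neg (sub_neg.2 hγ.2)]
    linarith [hγ.1]

lemma sidePt_eq_polarPt (v a : ℂ) (ε δ : ℝ) :
    sidePt v a ε δ = polarPt v a ‖(ε + δ * Complex.I : ℂ)‖ (ε + δ * Complex.I : ℂ).arg := by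
  simp only [sidePt, polarPt]
  rw [Complex.norm_mul_exp_arg_mul_I]

open Filter Topology in
lemma sidePt_eventually_mem_sector {v a : ℂ} {β R r : ℝ} (hβ0 : 0 < β) (hR : 0 < R)
    (hr : 0 < r) {N : Set ℂ} (hN : ∀ ρ ∈ Ioo 0 r, ∀ γ ∈ Ioo 0 β, polarPt v a ρ γ ∈ N) :
    ∃ e > 0, ∀ ε ∈ Ioo 0 e, ∀ᶠ δ in 𝓝[>] (0 : ℝ), sidePt v a ε δ ∈ N ∧
      sidePt v (polarPt v a R β) ε (-δ) ∈ N := by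
  refine ⟨min r (r / R), lt_min hr (div_pos hr hR), fun ε hε => ?_⟩
  have hε1 := hε.2.trans_le (min_le_left _ _)
  have hε2 := (lt_div_iff₀ hR).1 (hε.2.trans_le (min_le_right _ _))
  have hnorm : Tendsto (fun δ : ℝ => ‖(ε + δ * Complex.I : ℂ)‖) (𝓝 0) (𝓝 ε) := by
    have : Continuous (fun δ : ℝ => ‖(ε + δ * Complex.I : ℂ)‖) := by fun_prop
    have h := this.tendsto 0
    simpa [abs_of_pos hε.1] using h
  have harg : Tendsto (fun δ : ℝ => (ε + δ * Complex.I : ℂ).arg) (𝓝 0) (𝓝 0) := by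
    have hs : (ε + (0 : ℝ) * Complex.I : ℂ) ∈ Complex.slitPlane := by
      simp [Complex.mem_slitPlane_iff, hε.1]
    have h1 : ContinuousAt (fun δ : ℝ => (ε + δ * Complex.I : ℂ)) 0 := by fun_prop
    have h2 := ((Complex.continuousAt_arg hs).comp (f := fun δ : ℝ => (ε + δ * Complex.I : ℂ))
      h1).tendsto
    simpa [Function.comp_def, Complex.arg_ofReal_of_nonneg hε.1.le] using h2
  have hneg : Tendsto (fun δ : ℝ => -δ) (𝓝 0) (𝓝 0) := by
    simpa using (continuous_neg (G := ℝ)).tendsto 0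
  have hpos_norm : ∀ δ : ℝ, 0 < ‖(ε + δ * Complex.I : ℂ)‖ := fun δ => norm_pos_iff.2 fun h => by
    have := congrArg Complex.re h
    simp at this
    exact hε.1.ne' this
  have hargpos : ∀ δ : ℝ, 0 < δ → 0 < (ε + δ * Complex.I : ℂ).arg := fun δ hδ => by
    have h1 : 0 ≤ (ε + δ * Complex.I : ℂ).arg := Complex.arg_nonneg_iff.2 (by simpa using hδ.le)
    refine h1.lt_of_ne fun h => ?_
    have := (Complex.arg_eq_zero_iff.1 h.symm).2
    simp at this
    exact hδ.ne' this
  have hargneg : ∀ δ : ℝ, δ < 0 → (ε + δ * Complex.I : ℂ).arg < 0 := fun δ hδ =>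
    Complex.arg_neg_iff.2 (by simpa using hδ)
  filter_upwards [self_mem_nhdsWithin, nhdsWithin_le_nhds (hnorm.eventually (gt_mem_nhds hε1)),
    nhdsWithin_le_nhds ((hnorm.comp hneg).eventually
      (gt_mem_nhds ((lt_div_iff₀ hR).2 hε2))),
    nhdsWithin_le_nhds (harg.eventually (gt_mem_nhds hβ0)),
    nhdsWithin_le_nhds ((harg.comp hneg).eventually (lt_mem_nhds (neg_lt_zero.2 hβ0)))]
    with δ hδ h1 h2 h3 h4
  simp only [Function.comp_apply] at h2 h4
  refine ⟨?_, ?_⟩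
  · rw [sidePt_eq_polarPt]
    exact hN _ ⟨hpos_norm δ, h1⟩ _ ⟨hargpos δ hδ, h3⟩
  · rw [sidePt_eq_polarPt, polarPt_polarPt]
    have hδ' : -δ < 0 := neg_lt_zero.2 hδ
    refine hN _ ⟨mul_pos (hpos_norm _) hR, (lt_div_iff₀ hR).1 h2⟩ _ ⟨by linarith, ?_⟩
    linarith [hargneg _ hδ']

/-- The angle in `(0, 2π]` of `z` around `v`, measured counterclockwise from the ray through `a`. -/
noncomputable def angleFrom (v a z : ℂ) : ℝ := (-((z - v) / (a - v))).arg + Real.pi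

lemma angleFrom_le (v a z : ℂ) : angleFrom v a z ≤ 2 * Real.pi := by
  unfold angleFrom; linarith [Complex.arg_le_pi (-((z - v) / (a - v)))]

lemma angleFrom_pos (v a z : ℂ) : 0 < angleFrom v a z := by
  unfold angleFrom; linarith [Complex.neg_pi_lt_arg (-((z - v) / (a - v)))]

lemma polarPt_angleFrom {v a : ℂ} (hav : a ≠ v) (z : ℂ) :
    polarPt v a (‖z - v‖ / ‖a - v‖) (angleFrom v a z) = z := by
  have hd := sub_ne_zero.2 hav
  have h := Complex.norm_mul_exp_arg_mul_I (-((z - v) / (a - v)))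
  rw [norm_neg, norm_div] at h
  simp only [polarPt, angleFrom]
  rw [Complex.ofReal_add, add_mul, Complex.exp_add, Complex.exp_pi_mul_I]
  have : ((‖z - v‖ / ‖a - v‖ : ℝ) : ℂ) *
      (Complex.exp (((-((z - v) / (a - v))).arg : ℝ) * Complex.I) * -1) * (a - v) =
      -(((‖z - v‖ / ‖a - v‖ : ℝ) : ℂ) *
      Complex.exp (((-((z - v) / (a - v))).arg : ℝ) * Complex.I)) * (a - v) := by ring
  rw [this, h]
  field_simp
  ring

lemma neg_div_mem_slitPlane {v a z : ℂ} (hav : a ≠ v) (hz : z ≠ v)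
    (h : ∀ t : ℝ, 0 < t → z - v ≠ t * (a - v)) : -((z - v) / (a - v)) ∈ Complex.slitPlane := by
  by_contra hc
  rw [Complex.mem_slitPlane_iff, not_or, not_lt, not_not] at hc
  have hd := sub_ne_zero.2 hav
  set w := (z - v) / (a - v) with hw
  have hw' : w = ((w.re : ℝ) : ℂ) := by
    apply Complex.ext
    · simp
    · simpa using hc.2
  have hzw : z - v = (w.re : ℝ) * (a - v) := by rw [← hw', hw, div_mul_cancel₀ _ hd]
  have h0 : 0 ≤ w.re := by simpa using hc.1
  rcases h0.eq_or_lt with h0 | h0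
  · rw [← h0, Complex.ofReal_zero, zero_mul] at hzw
    exact hz (sub_eq_zero.1 hzw)
  · exact h _ h0 hzw

lemma angleFrom_lt {v a z : ℂ} (hav : a ≠ v) (hz : z ≠ v)
    (h : ∀ t : ℝ, 0 < t → z - v ≠ t * (a - v)) : angleFrom v a z < 2 * Real.pi := by
  have := Complex.mem_slitPlane_iff_arg.1 (neg_div_mem_slitPlane hav hz h)
  have h2 := Complex.arg_le_pi (-((z - v) / (a - v)))
  unfold angleFrom
  linarith [h2.lt_of_ne this.1]

open Filter Topology in
/-- The open sector at `v` counterclockwise from the ray through `a` to the ray through `b`. -/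
theorem exists_wedge {v a b : ℂ} (hav : a ≠ v) (hbv : b ≠ v)
    (h : ∀ t : ℝ, 0 < t → b - v ≠ t * (a - v)) {K : Set ℂ} (hK : IsClosed K) (hv : v ∉ K) :
    ∃ N, IsPreconnected N ∧ Disjoint N K ∧ Disjoint N (segment ℝ v a) ∧
      Disjoint N (segment ℝ v b) ∧
      (∃ r > 0, ∀ ρ ∈ Ioo 0 r, ∀ γ ∈ Ioo 0 (angleFrom v a b), polarPt v a ρ γ ∈ N) ∧
      ∃ e > 0, ∀ ε ∈ Ioo 0 e, ∀ᶠ δ in 𝓝[>] (0 : ℝ), sidePt v a ε δ ∈ N ∧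
        sidePt v b ε (-δ) ∈ N := by
  have hR : 0 < ‖b - v‖ / ‖a - v‖ :=
    div_pos (norm_pos_iff.2 (sub_ne_zero.2 hbv)) (norm_pos_iff.2 (sub_ne_zero.2 hav))
  obtain ⟨N, h1, h2, h3, h4, r, hr, h5⟩ := exists_sector hav (angleFrom_lt hav hbv h) hR hK hv
  have h6 := sidePt_eventually_mem_sector (angleFrom_pos v a b) hR hr h5
  rw [polarPt_angleFrom hav] at h4 h6
  exact ⟨N, h1, h2, h3, h4, ⟨r, hr, h5⟩, h6⟩

open Filter Topology in
lemma inter_nonempty_of_sidePt {F N : Set ℂ} (hF : IsOpen F) {a b : ℂ} {ε : ℝ}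
    (h : sidePt a b ε 0 ∈ F) (hN : ∀ᶠ δ in 𝓝[>] (0 : ℝ), sidePt a b ε δ ∈ N) :
    (N ∩ F).Nonempty := by
  have h1 : ∀ᶠ δ in 𝓝[>] (0 : ℝ), sidePt a b ε δ ∈ F :=
    nhdsWithin_le_nhds (((continuous_sidePt a b ε).tendsto 0).eventually (hF.mem_nhds h))
  obtain ⟨δ, h2, h3⟩ := (hN.and h1).exists
  exact ⟨_, h2, h3⟩

lemma sidePt_zero_notMem_segment {v a b : ℂ} (hav : a ≠ v)
    (h : ∀ t : ℝ, 0 < t → b - v ≠ t * (a - v)) {ε : ℝ} (hε : 0 < ε) :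
    sidePt v a ε 0 ∉ segment ℝ v b := by
  rw [segment_eq_sidePt]
  rintro ⟨t, ht, he⟩
  simp only [sidePt, Complex.ofReal_zero, zero_mul, add_zero] at he
  have h1 := add_left_cancel he
  rcases ht.1.eq_or_lt with h0 | h0
  · rw [← h0, Complex.ofReal_zero, zero_mul] at h1
    rcases mul_eq_zero.1 h1.symm with h2 | h2
    · exact hε.ne' (by exact_mod_cast h2)
    · exact hav (sub_eq_zero.1 h2)
  · refine h (ε / t) (div_pos hε h0) ?_
    have : (t : ℂ) ≠ 0 := by exact_mod_cast h0.ne'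
    push_cast
    field_simp
    linear_combination h1

lemma dir_symm {v a b : ℂ} (h : ∀ t : ℝ, 0 < t → b - v ≠ t * (a - v)) :
    ∀ t : ℝ, 0 < t → a - v ≠ t * (b - v) := by
  intro t ht he
  refine h t⁻¹ (inv_pos.2 ht) ?_
  have : (t : ℂ) ≠ 0 := by exact_mod_cast ht.ne'
  rw [he]; push_cast; field_simp

open Filter Topology in
lemma eventually_sidePt_notMem {v a : ℂ} {R : Set ℂ} (hR : IsClosed R) (hv : v ∉ R) :
    ∃ e > 0, ∀ ε ∈ Ioo 0 e, sidePt v a ε 0 ∉ R := by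
  have hc : Continuous fun ε : ℝ => sidePt v a ε 0 := by unfold sidePt; fun_prop
  have h0 : sidePt v a 0 0 ∈ Rᶜ := by simpa [sidePt] using hv
  have h1 : ∀ᶠ ε in 𝓝 (0 : ℝ), sidePt v a ε 0 ∈ Rᶜ :=
    (hc.tendsto 0).eventually (hR.isOpen_compl.mem_nhds h0)
  obtain ⟨e, he, h2⟩ := Metric.eventually_nhds_iff.1 h1
  refine ⟨e, he, fun ε hε => h2 ?_⟩
  rw [Real.dist_eq, sub_zero, abs_of_pos hε.1]
  exact hε.2

open Filter Topology in
/-- The two sectors at a vertex `v` of a closed curve lie in different components of the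
complement of the curve. -/
theorem exists_sectors {v x s : ℂ} {R F : Set ℂ} (hR : IsClosed R) (hl : HasAngleLift R x s)
    (hvR : v ∉ R) (hxv : x ≠ v) (hsv : s ≠ v) (hdir : ∀ t : ℝ, 0 < t → s - v ≠ t * (x - v))
    (hF : IsOpen F) (hsF : ∀ t ∈ Ioc (0 : ℝ) 1, sidePt v s t 0 ∈ F) :
    ∃ N N' : Set ℂ, IsPreconnected N ∧ IsPreconnected N' ∧
      Disjoint N (segment ℝ v s ∪ segment ℝ v x ∪ R) ∧
      Disjoint N' (segment ℝ v s ∪ segment ℝ v x ∪ R) ∧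
      (N ∩ F).Nonempty ∧ (N' ∩ F).Nonempty ∧
      (∃ r > 0, ∀ ρ ∈ Ioo 0 r, ∀ γ ∈ Ioo 0 (angleFrom v x s), polarPt v x ρ γ ∈ N) ∧
      (∃ r > 0, ∀ ρ ∈ Ioo 0 r, ∀ γ ∈ Ioo 0 (angleFrom v s x), polarPt v s ρ γ ∈ N') ∧
      (∃ e > 0, ∀ ε ∈ Ioo 0 e, ∀ᶠ δ in 𝓝[>] (0 : ℝ), sidePt v x ε δ ∈ N ∧
        sidePt v x ε (-δ) ∈ N') ∧
      ∀ T, IsPreconnected T → Disjoint T (segment ℝ v s ∪ segment ℝ v x ∪ R) →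
        N ⊆ T → N' ⊆ T → False := by
  obtain ⟨N, n1, n2, n3, n4, n5, e, he, n6⟩ := exists_wedge hxv hsv hdir hR hvR
  obtain ⟨N', m1, m2, m3, m4, m5, e', he', m6⟩ := exists_wedge hsv hxv (dir_symm hdir) hR hvR
  obtain ⟨e'', he'', hnot⟩ := eventually_sidePt_notMem (a := x) hR hvR
  have hmin : 0 < min (min e e') (min e'' 1) := by positivity
  obtain ⟨ε, hε⟩ : ∃ ε, ε ∈ Ioo 0 (min (min e e') (min e'' 1)) := nonempty_Ioo.2 hmin
  have hεe : ε ∈ Ioo 0 e := ⟨hε.1, hε.2.trans_le ((min_le_left _ _).trans (min_le_left _ _))⟩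
  have hεe' : ε ∈ Ioo 0 e' := ⟨hε.1, hε.2.trans_le ((min_le_left _ _).trans (min_le_right _ _))⟩
  have hεe'' : ε ∈ Ioo 0 e'' :=
    ⟨hε.1, hε.2.trans_le ((min_le_right _ _).trans (min_le_left _ _))⟩
  have hε1 : ε < 1 := hε.2.trans_le ((min_le_right _ _).trans (min_le_right _ _))
  have hboth : ∀ ε ∈ Ioo 0 (min e e'), ∀ᶠ δ in 𝓝[>] (0 : ℝ), sidePt v x ε δ ∈ N ∧
      sidePt v x ε (-δ) ∈ N' := by
    intro ε hε
    filter_upwards [n6 ε ⟨hε.1, hε.2.trans_le (min_le_left _ _)⟩,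
      m6 ε ⟨hε.1, hε.2.trans_le (min_le_right _ _)⟩] with δ h1 h2
    exact ⟨h1.1, h2.2⟩
  refine ⟨N, N', n1, m1, ?_, ?_, ?_, ?_, n5, m5, ⟨min e e', by positivity, hboth⟩, ?_⟩
  · rw [disjoint_union_right, disjoint_union_right]; exact ⟨⟨n4, n3⟩, n2⟩
  · rw [disjoint_union_right, disjoint_union_right]; exact ⟨⟨m3, m4⟩, m2⟩
  · refine inter_nonempty_of_sidePt hF (a := s) (b := v) (ε := 1 - ε) (N := N) ?_ ?_
    · have := sidePt_symm v s ε 0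
      rw [neg_zero] at this
      rw [this]; exact hsF ε ⟨hε.1, hε1.le⟩
    · filter_upwards [n6 ε hεe] with δ hδ
      have := sidePt_symm v s ε (-δ)
      rw [neg_neg] at this
      rw [this]; exact hδ.2
  · refine inter_nonempty_of_sidePt hF (hsF ε ⟨hε.1, hε1.le⟩) ?_
    filter_upwards [m6 ε hεe'] with δ hδ using hδ.1
  · intro T hT hTJ hNT hNT'
    have hl' : HasAngleLift (R ∪ segment ℝ s v) x v := hl.trans (hasAngleLift_segment s v)
    refine sides_separated (T := T) (ε := ε) (hR.union (isCompact_segment s v).isClosed) hl' hxv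
      hε.1 hε1 ?_ hT ?_ ?_ ?_
    · rw [mem_union, not_or]
      refine ⟨hnot ε hεe'', ?_⟩
      rw [segment_symm]
      exact sidePt_zero_notMem_segment hxv hdir hε.1
    · rw [disjoint_union_right, disjoint_union_right] at hTJ ⊢
      rw [segment_symm ℝ s v]
      exact ⟨⟨hTJ.2, hTJ.1.1⟩, hTJ.1.2⟩
    · filter_upwards [n6 ε hεe] with δ hδ using hNT hδ.1
    · have h1 : ∀ᶠ δ in 𝓝[>] (0 : ℝ), sidePt v x ε (-δ) ∈ T := by
        filter_upwards [m6 ε hεe'] with δ hδ using hNT' hδ.2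
      have h2 : Tendsto (fun δ : ℝ => -δ) (𝓝[<] 0) (𝓝[>] 0) := by
        simpa using tendsto_neg_nhdsLT (a := (0 : ℝ))
      simpa using h2.eventually h1

open Filter Topology in
lemma isPreconnected_union_of_eventually {N M : Set ℂ} (hN : IsPreconnected N)
    (hM : IsPreconnected M) {f : ℝ → ℂ} (h1 : ∀ᶠ δ in 𝓝[>] (0 : ℝ), f δ ∈ N)
    (h2 : ∀ᶠ δ in 𝓝[>] (0 : ℝ), f δ ∈ M) : IsPreconnected (N ∪ M) := by
  obtain ⟨δ, h3, h4⟩ := (h1.and h2).exists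
  exact hN.union _ h3 h4 hM

lemma sidePt_symm_neg (a b : ℂ) (ε δ : ℝ) : sidePt b a (1 - ε) δ = sidePt a b ε (-δ) := by
  have := sidePt_symm a b ε (-δ)
  rwa [neg_neg] at this

open Filter Topology in
/-- The two sides of the first segment `[v, x]` of a closed curve, together with the adjacent
sectors at `v`. -/
theorem exists_sides {v x s : ℂ} {R F : Set ℂ} (hR : IsClosed R) (hl : HasAngleLift R x s)
    (hvR : v ∉ R) (hxR : x ∈ R) (hxv : x ≠ v) (hsv : s ≠ v)
    (hdir : ∀ t : ℝ, 0 < t → s - v ≠ t * (x - v))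
    (hxo : ∀ ε ∈ Ioo (0 : ℝ) 1, sidePt v x ε 0 ∉ R)
    (hF : IsOpen F) (hsF : ∀ t ∈ Ioc (0 : ℝ) 1, sidePt v s t 0 ∈ F) :
    ∃ N N' : Set ℂ, IsPreconnected N ∧ IsPreconnected N' ∧
      Disjoint N (segment ℝ v s ∪ segment ℝ v x ∪ R) ∧
      Disjoint N' (segment ℝ v s ∪ segment ℝ v x ∪ R) ∧
      (N ∩ F).Nonempty ∧ (N' ∩ F).Nonempty ∧
      segment ℝ v x ⊆ closure N ∧ segment ℝ v x ⊆ closure N' ∧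
      (∀ ε ∈ Ioo (0 : ℝ) 1, ∀ᶠ δ in 𝓝[>] (0 : ℝ), sidePt v x ε δ ∈ N ∧
        sidePt v x ε (-δ) ∈ N') ∧
      ∀ T, IsPreconnected T → Disjoint T (segment ℝ v s ∪ segment ℝ v x ∪ R) →
        N ⊆ T → N' ⊆ T → False := by
  obtain ⟨N, N', n1, m1, n2, m2, n3, m3, -, -, ⟨e, he, hev⟩, hsep⟩ :=
    exists_sectors hR hl hvR hxv hsv hdir hF hsF
  have hS : IsClosed (segment ℝ v s ∪ R) := (isCompact_segment v s).isClosed.union hR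
  have hSo : ∀ ε ∈ Ioo (0 : ℝ) 1, sidePt v x ε 0 ∉ segment ℝ v s ∪ R := by
    intro ε hε
    rw [mem_union, not_or]
    exact ⟨sidePt_zero_notMem_segment hxv hdir hε.1, hxo ε hε⟩
  obtain ⟨S, s1, s2, s3, s4, s5⟩ := exists_strip hxv.symm hS ⟨x, Or.inr hxR⟩ hSo
  obtain ⟨S', t1, t2, t3, t4, t5⟩ := exists_strip hxv hS ⟨x, Or.inr hxR⟩ (fun ε hε => by
    have := sidePt_symm v x (1 - ε) 0
    rw [neg_zero, sub_sub_cancel] at this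
    rw [this]
    exact hSo _ ⟨by linarith [hε.2], by linarith [hε.1]⟩)
  rw [segment_symm] at t3 t4
  have t5' : ∀ ε ∈ Ioo (0 : ℝ) 1, ∀ᶠ δ in 𝓝[>] (0 : ℝ), sidePt v x ε (-δ) ∈ S' := by
    intro ε hε
    filter_upwards [t5 (1 - ε) ⟨by linarith [hε.2], by linarith [hε.1]⟩] with δ hδ
    rwa [sidePt_symm_neg] at hδ
  obtain ⟨ε, hε⟩ : ∃ ε, ε ∈ Ioo 0 (min e 1) := nonempty_Ioo.2 (by positivity)
  have hεe : ε ∈ Ioo 0 e := ⟨hε.1, hε.2.trans_le (min_le_left _ _)⟩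
  have hε1 : ε ∈ Ioo (0 : ℝ) 1 := ⟨hε.1, hε.2.trans_le (min_le_right _ _)⟩
  refine ⟨N ∪ S, N' ∪ S', ?_, ?_, ?_, ?_, ?_, ?_, ?_, ?_, ?_, ?_⟩
  · exact isPreconnected_union_of_eventually n1 s1 ((hev ε hεe).mono fun _ h => h.1) (s5 ε hε1)
  · exact isPreconnected_union_of_eventually m1 t1 ((hev ε hεe).mono fun _ h => h.2) (t5' ε hε1)
  · rw [disjoint_union_left]
    refine ⟨n2, ?_⟩
    rw [disjoint_union_right] at s2
    simp only [disjoint_union_right]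
    exact ⟨⟨s2.1, s3⟩, s2.2⟩
  · rw [disjoint_union_left]
    refine ⟨m2, ?_⟩
    rw [disjoint_union_right] at t2
    simp only [disjoint_union_right]
    exact ⟨⟨t2.1, t3⟩, t2.2⟩
  · exact n3.mono (inter_subset_inter_left _ subset_union_left)
  · exact m3.mono (inter_subset_inter_left _ subset_union_left)
  · exact s4.trans (closure_mono subset_union_right)
  · exact t4.trans (closure_mono subset_union_right)
  · intro ε hε
    filter_upwards [s5 ε hε, t5' ε hε] with δ h1 h2
    exact ⟨Or.inr h1, Or.inr h2⟩
  · intro T hT hTJ h1 h2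
    exact hsep T hT hTJ (subset_union_left.trans h1) (subset_union_left.trans h2)

open Filter Topology in
/-- Continuing the left side of `[v, x]` along a further segment `[x, u]`. -/
theorem extend_side {v x u : ℂ} {R N : Set ℂ} (hR : IsClosed R) (hvx : v ≠ x) (hux : u ≠ x)
    (hdir : ∀ t : ℝ, 0 < t → v - x ≠ t * (u - x)) (hxR : x ∉ R)
    (huo : ∀ ε ∈ Ioo (0 : ℝ) 1, sidePt x u ε 0 ∉ R) (hN : IsPreconnected N)
    (hNJ : Disjoint N (segment ℝ x v ∪ segment ℝ x u ∪ R))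
    (hNs : ∀ ε ∈ Ioo (0 : ℝ) 1, ∀ᶠ δ in 𝓝[>] (0 : ℝ), sidePt v x ε δ ∈ N) :
    ∃ M, N ⊆ M ∧ IsPreconnected M ∧ Disjoint M (segment ℝ x v ∪ segment ℝ x u ∪ R) ∧
      segment ℝ x u ⊆ closure M := by
  obtain ⟨W, w1, w2, w3, w4, -, e, he, hev⟩ := exists_wedge hux hvx hdir hR hxR
  have hS : IsClosed (segment ℝ x v ∪ R) := (isCompact_segment x v).isClosed.union hR
  obtain ⟨S, s1, s2, s3, s4, s5⟩ := exists_strip hux.symm hS ⟨x, Or.inl (left_mem_segment ℝ x v)⟩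
    (fun ε hε => by
      rw [mem_union, not_or]
      exact ⟨sidePt_zero_notMem_segment hux hdir hε.1, huo ε hε⟩)
  obtain ⟨ε, hε⟩ : ∃ ε, ε ∈ Ioo 0 (min e 1) := nonempty_Ioo.2 (by positivity)
  have hεe : ε ∈ Ioo 0 e := ⟨hε.1, hε.2.trans_le (min_le_left _ _)⟩
  have hε1 : ε ∈ Ioo (0 : ℝ) 1 := ⟨hε.1, hε.2.trans_le (min_le_right _ _)⟩
  have hWS := isPreconnected_union_of_eventually w1 s1 ((hev ε hεe).mono fun _ h => h.1)
    (s5 ε hε1)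
  rw [disjoint_union_right] at s2
  refine ⟨N ∪ (W ∪ S), subset_union_left, ?_, ?_, ?_⟩
  · refine isPreconnected_union_of_eventually hN hWS (f := fun δ => sidePt v x (1 - ε) δ)
      (hNs (1 - ε) ⟨by linarith [hε1.2], by linarith [hε1.1]⟩) ?_
    filter_upwards [hev ε hεe] with δ hδ
    rw [sidePt_symm_neg]
    exact Or.inl hδ.2
  · simp only [disjoint_union_left]
    refine ⟨hNJ, ?_, ?_⟩
    · simp only [disjoint_union_right]
      exact ⟨⟨w4, w3⟩, w2⟩
    · simp only [disjoint_union_right]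
      exact ⟨⟨s2.1, s3⟩, s2.2⟩
  · exact s4.trans (closure_mono (subset_union_right.trans subset_union_right))

open Filter Topology in
/-- Continuing the right side of `[v, x]` along a further segment `[x, u]`. -/
theorem extend_side' {v x u : ℂ} {R N : Set ℂ} (hR : IsClosed R) (hvx : v ≠ x) (hux : u ≠ x)
    (hdir : ∀ t : ℝ, 0 < t → v - x ≠ t * (u - x)) (hxR : x ∉ R)
    (huo : ∀ ε ∈ Ioo (0 : ℝ) 1, sidePt x u ε 0 ∉ R) (hN : IsPreconnected N)
    (hNJ : Disjoint N (segment ℝ x v ∪ segment ℝ x u ∪ R))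
    (hNs : ∀ ε ∈ Ioo (0 : ℝ) 1, ∀ᶠ δ in 𝓝[>] (0 : ℝ), sidePt v x ε (-δ) ∈ N) :
    ∃ M, N ⊆ M ∧ IsPreconnected M ∧ Disjoint M (segment ℝ x v ∪ segment ℝ x u ∪ R) ∧
      segment ℝ x u ⊆ closure M := by
  obtain ⟨W, w1, w2, w3, w4, -, e, he, hev⟩ := exists_wedge hvx hux (dir_symm hdir) hR hxR
  have hS : IsClosed (segment ℝ x v ∪ R) := (isCompact_segment x v).isClosed.union hR
  obtain ⟨S, s1, s2, s3, s4, s5⟩ := exists_strip hux hS ⟨x, Or.inl (left_mem_segment ℝ x v)⟩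
    (fun ε hε => by
      have := sidePt_symm_neg x u (1 - ε) 0
      rw [neg_zero, sub_sub_cancel] at this
      rw [this, mem_union, not_or]
      exact ⟨sidePt_zero_notMem_segment hux hdir (by linarith [hε.2]),
        huo _ ⟨by linarith [hε.2], by linarith [hε.1]⟩⟩)
  rw [segment_symm] at s3 s4
  obtain ⟨ε, hε⟩ : ∃ ε, ε ∈ Ioo 0 (min e 1) := nonempty_Ioo.2 (by positivity)
  have hεe : ε ∈ Ioo 0 e := ⟨hε.1, hε.2.trans_le (min_le_left _ _)⟩
  have hε1 : 1 - ε ∈ Ioo (0 : ℝ) 1 :=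
    ⟨by linarith [hε.2.trans_le (min_le_right e 1)], by linarith [hε.1]⟩
  have hWS := isPreconnected_union_of_eventually w1 s1 (f := fun δ => sidePt u x (1 - ε) δ)
    ((hev ε hεe).mono fun δ h => by rw [sidePt_symm_neg]; exact h.2) (s5 (1 - ε) hε1)
  rw [disjoint_union_right] at s2
  refine ⟨N ∪ (W ∪ S), subset_union_left, ?_, ?_, ?_⟩
  · refine isPreconnected_union_of_eventually hN hWS (f := fun δ => sidePt v x (1 - ε) (-δ))
      (hNs (1 - ε) hε1) ?_
    filter_upwards [hev ε hεe] with δ hδ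
    rw [sidePt_symm]
    exact Or.inl hδ.1
  · simp only [disjoint_union_left]
    refine ⟨hNJ, ?_, ?_⟩
    · simp only [disjoint_union_right]
      exact ⟨⟨w3, w4⟩, w2⟩
    · simp only [disjoint_union_right]
      exact ⟨⟨s2.1, s3⟩, s2.2⟩
  · exact s4.trans (closure_mono (subset_union_right.trans subset_union_right))

/-- `z` draws `G` in the complex plane with straight edges. -/
structure IsDrawing {V : Type} (G : SimpleGraph V) (z : V → ℂ) : Prop where
  inj : Function.Injective z
  meet : ∀ ⦃a b c d : V⦄, G.Adj a b → G.Adj c d → s(a, b) ≠ s(c, d) →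
    segment ℝ (z a) (z b) ∩ segment ℝ (z c) (z d) ⊆ ({z a, z b} ∩ {z c, z d} : Set ℂ)
  off : ∀ ⦃a b v : V⦄, G.Adj a b → v ≠ a → v ≠ b → z v ∉ segment ℝ (z a) (z b)

/-- The part of the drawing spanned by the vertices in `S`. -/
def drawOn {V : Type} (G : SimpleGraph V) (z : V → ℂ) (S : Set V) : Set ℂ :=
  {p | (∃ a ∈ S, z a = p) ∨ ∃ a ∈ S, ∃ b ∈ S, G.Adj a b ∧ p ∈ segment ℝ (z a) (z b)}

lemma drawOn_mono {V : Type} (G : SimpleGraph V) (z : V → ℂ) {S T : Set V} (h : S ⊆ T) :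
    drawOn G z S ⊆ drawOn G z T := by
  rintro p (⟨a, ha, rfl⟩ | ⟨a, ha, b, hb, hab, hp⟩)
  · exact Or.inl ⟨a, h ha, rfl⟩
  · exact Or.inr ⟨a, h ha, b, h hb, hab, hp⟩

lemma isClosed_drawOn {V : Type} [Finite V] (G : SimpleGraph V) (z : V → ℂ) (S : Set V) :
    IsClosed (drawOn G z S) := by
  have : drawOn G z S = (z '' S) ∪ ⋃ e ∈ {e : V × V | e.1 ∈ S ∧ e.2 ∈ S ∧ G.Adj e.1 e.2},
      segment ℝ (z e.1) (z e.2) := by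
    ext p
    simp only [drawOn, mem_union, mem_image, mem_iUnion, Prod.exists, mem_ofPred_eq]
    constructor
    · rintro (h | ⟨a, ha, b, hb, hab, hp⟩)
      · exact Or.inl h
      · exact Or.inr ⟨a, b, ⟨ha, hb, hab⟩, hp⟩
    · rintro (h | ⟨a, b, ⟨ha, hb, hab⟩, hp⟩)
      · exact Or.inl h
      · exact Or.inr ⟨a, ha, b, hb, hab, hp⟩
  rw [this]
  refine (Set.toFinite _).isClosed.union ?_
  exact (Set.toFinite _).isClosed_biUnion fun e _ => (isCompact_segment _ _).isClosed

/-- The face of the drawing of `G[S]` containing `q`. -/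
def faceOn {V : Type} (G : SimpleGraph V) (z : V → ℂ) (q : ℂ) (S : Set V) : Set ℂ :=
  connectedComponentIn (drawOn G z S)ᶜ q

section Face

variable {V : Type} {G : SimpleGraph V} {z : V → ℂ} {q : ℂ}

lemma isPreconnected_faceOn (S : Set V) : IsPreconnected (faceOn G z q S) :=
  isPreconnected_connectedComponentIn

lemma notMem_of_mem_faceOn {S : Set V} {p : ℂ} (hp : p ∈ faceOn G z q S) : p ∉ drawOn G z S :=
  connectedComponentIn_subset _ _ hp

lemma isOpen_faceOn [Finite V] (S : Set V) : IsOpen (faceOn G z q S) :=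
  (isClosed_drawOn G z S).isOpen_compl.connectedComponentIn

lemma faceOn_anti {S T : Set V} (h : S ⊆ T) :
    faceOn G z q T ⊆ faceOn G z q S :=
  connectedComponentIn_mono _ (compl_subset_compl.2 (drawOn_mono G z h))

lemma subset_faceOn {S : Set V} {N : Set ℂ} (hN : IsPreconnected N)
    (h : (N ∩ faceOn G z q S).Nonempty) (hd : ∀ p ∈ N, p ∉ drawOn G z S) :
    N ⊆ faceOn G z q S := by
  obtain ⟨p, h1, h2⟩ := h
  have : faceOn G z q S = connectedComponentIn (drawOn G z S)ᶜ p := connectedComponentIn_eq h2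
  rw [this]
  exact hN.subset_connectedComponentIn h1 hd

lemma IsDrawing.notMem_drawOn_compl (hD : IsDrawing G z) (v : V) : z v ∉ drawOn G z {v}ᶜ := by
  rintro (⟨a, ha, h⟩ | ⟨a, ha, b, hb, hab, hp⟩)
  · exact ha (hD.inj h)
  · exact hD.off hab (fun h => ha h.symm) (fun h => hb h.symm) hp

lemma exists_ball [Finite V] (hD : IsDrawing G z) (v : V) :
    ∃ r > 0, ∀ p, dist p (z v) < r → p ∉ drawOn G z {v}ᶜ := by
  obtain ⟨r, hr, h⟩ := Metric.isOpen_iff.1 (isClosed_drawOn G z {v}ᶜ).isOpen_compl (z v)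
    (hD.notMem_drawOn_compl v)
  exact ⟨r, hr, fun p hp => h hp⟩

lemma isPreconnected_sidePt_image (a b : ℂ) {s : Set ℝ} (hs : IsPreconnected s) :
    IsPreconnected ((fun t : ℝ => sidePt a b t 0) '' s) := by
  refine hs.image _ (Continuous.continuousOn ?_)
  unfold sidePt; fun_prop

lemma sidePt_one (a b : ℂ) : sidePt a b 1 0 = b := by simp [sidePt]

lemma sidePt_zero (a b : ℂ) : sidePt a b 0 0 = a := by simp [sidePt]

lemma dist_sidePt (a b : ℂ) (t : ℝ) : dist (sidePt a b t 0) a = |t| * dist b a := by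
  simp [sidePt, dist_eq_norm]

lemma sidePt_mem_segment {a b : ℂ} {t : ℝ} (ht : t ∈ Icc (0 : ℝ) 1) :
    sidePt a b t 0 ∈ segment ℝ a b := by
  rw [segment_eq_sidePt]; exact ⟨t, ht, rfl⟩

/-- Points of a face close to a vertex are joined to it by a segment inside the face. -/
theorem exists_access [Finite V] (hD : IsDrawing G z) (v : V) :
    ∃ r > 0, (∀ p, dist p (z v) < r → p ∉ drawOn G z {v}ᶜ) ∧
      ∀ p ∈ faceOn G z q univ, dist p (z v) < r →
      ∀ t ∈ Ioc (0 : ℝ) 1, sidePt (z v) p t 0 ∈ faceOn G z q univ := by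
  obtain ⟨r, hr, hball⟩ := exists_ball hD v
  refine ⟨r, hr, hball, fun p hpF hpr => ?_⟩
  have hpv : p ≠ z v := fun h => notMem_of_mem_faceOn hpF (Or.inl ⟨v, mem_univ v, h.symm⟩)
  have hsub : (fun t : ℝ => sidePt (z v) p t 0) '' Ioc 0 1 ⊆ faceOn G z q univ := by
    refine subset_faceOn (isPreconnected_sidePt_image _ _ isPreconnected_Ioc)
      ⟨p, ⟨1, by simp, sidePt_one _ _⟩, hpF⟩ ?_
    rintro _ ⟨t, ht, rfl⟩ hmem
    have hdist : dist (sidePt (z v) p t 0) (z v) < r := by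
      rw [dist_sidePt, abs_of_pos ht.1]
      nlinarith [ht.2, dist_nonneg (x := p) (y := z v)]
    have hnot := hball _ hdist
    have key : ∀ b, G.Adj v b → sidePt (z v) p t 0 ∉ segment ℝ (z v) (z b) := by
      intro b hvb h
      rw [segment_eq_sidePt] at h
      obtain ⟨τ, hτ, he⟩ := h
      simp only [sidePt, Complex.ofReal_zero, zero_mul, add_zero] at he
      have he' := add_left_cancel he
      have ht0 : (t : ℂ) ≠ 0 := by exact_mod_cast ht.1.ne'
      rcases le_or_gt τ t with hle | hlt
      · refine notMem_of_mem_faceOn hpF (Or.inr ⟨v, mem_univ v, b, mem_univ b, hvb, ?_⟩)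
        have : p = sidePt (z v) (z b) (τ / t) 0 := by
          simp only [sidePt]; push_cast; field_simp; linear_combination -he'
        rw [this]
        exact sidePt_mem_segment ⟨div_nonneg hτ.1 ht.1.le, (div_le_one ht.1).2 hle⟩
      · have hτ0 : 0 < τ := ht.1.trans hlt
        have hτ1 : (τ : ℂ) ≠ 0 := by exact_mod_cast hτ0.ne'
        have : z b = sidePt (z v) p (t / τ) 0 := by
          simp only [sidePt]; push_cast; field_simp; linear_combination he'
        refine hball (z b) ?_ (Or.inl ⟨b, hvb.ne', rfl⟩)
        have h1 : t / τ ≤ 1 := (div_le_one hτ0).2 hlt.le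
        rw [this, dist_sidePt, abs_of_pos (div_pos ht.1 hτ0)]
        nlinarith [dist_nonneg (x := p) (y := z v)]
    rcases hmem with ⟨a, -, h⟩ | ⟨a, -, b, -, hab, h⟩
    · by_cases hav : a = v
      · subst hav
        have h0 : dist (sidePt (z a) p t 0) (z a) = 0 := by
          have h' : z a = sidePt (z a) p t 0 := h
          rw [← h', dist_self]
        rw [dist_sidePt] at h0
        rcases mul_eq_zero.1 h0 with h1 | h1
        · exact ht.1.ne' (abs_eq_zero.1 h1)
        · exact hpv (dist_eq_zero.1 h1)
      · exact hnot (Or.inl ⟨a, hav, h⟩)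
    · by_cases hav : a = v
      · subst hav; exact key b hab h
      · by_cases hbv : b = v
        · subst hbv; rw [segment_symm] at h; exact key a hab.symm h
        · exact hnot (Or.inr ⟨a, hav, b, hbv, hab, h⟩)
  intro t ht
  exact hsub ⟨t, ht, rfl⟩

/-- A closed curve meeting the drawing only in the vertices and edges of `Q` splits the
remaining vertices in two parts without edges between them. -/
theorem split_of_separated (hD : IsDrawing G z) {Q : Set V} {J N N' : Set ℂ}
    (hJQ : ∀ y, z y ∈ J ↔ y ∈ Q)
    (hJe : ∀ a b, G.Adj a b → a ∉ Q → ∀ p ∈ segment ℝ (z a) (z b), p ∈ J → p = z b)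
    (hJe' : ∀ a ∈ Q, ∀ b ∈ Q, G.Adj a b → segment ℝ (z a) (z b) ⊆ J)
    (hN : IsPreconnected N) (hN' : IsPreconnected N') (hNJ : Disjoint N J) (hNJ' : Disjoint N' J)
    (hNF : (N ∩ faceOn G z q univ).Nonempty) (hNF' : (N' ∩ faceOn G z q univ).Nonempty)
    (hsep : ∀ T, IsPreconnected T → Disjoint T J → N ⊆ T → N' ⊆ T → False) :
    ∃ A B : Set V, Disjoint A B ∧ (∀ y, y ∈ Q ↔ y ∉ A ∧ y ∉ B) ∧
      (∀ a ∈ A, ∀ b ∈ B, ¬ G.Adj a b) ∧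
      N ⊆ faceOn G z q Aᶜ ∧ N' ⊆ faceOn G z q Bᶜ ∧
      (∀ T, IsPreconnected T → Disjoint T J → (N ∩ T).Nonempty → ∀ y, z y ∈ T → y ∈ A) ∧
      (∀ T, IsPreconnected T → Disjoint T J → (N' ∩ T).Nonempty → ∀ y, z y ∈ T → y ∈ B) := by
  obtain ⟨n0, hn0, hn0F⟩ := hNF
  obtain ⟨n1, hn1, hn1F⟩ := hNF'
  set C := connectedComponentIn Jᶜ n0 with hC
  have hCJ : Disjoint C J := disjoint_left.2 fun p hp => connectedComponentIn_subset _ _ hp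
  have hCp : IsPreconnected C := isPreconnected_connectedComponentIn
  have hsubC : ∀ T, IsPreconnected T → Disjoint T J → (C ∩ T).Nonempty → T ⊆ C := by
    rintro T hT hTJ ⟨p, hpC, hpT⟩
    rw [hC, connectedComponentIn_eq hpC]
    exact hT.subset_connectedComponentIn hpT fun y hy => disjoint_left.1 hTJ hy
  have hn0C : n0 ∈ C := mem_connectedComponentIn (disjoint_left.1 hNJ hn0)
  have hNC : N ⊆ C := hsubC N hN hNJ ⟨n0, hn0C, hn0⟩
  have hN'C : Disjoint N' C := by
    rw [disjoint_left]
    intro p hp hpC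
    exact hsep C hCp hCJ hNC (hsubC N' hN' hNJ' ⟨p, hpC, hp⟩)
  have hedge : ∀ a b, G.Adj a b → a ∉ Q → ∀ p ∈ segment ℝ (z a) (z b), p ≠ z b →
      (p ∈ C ↔ z a ∈ C) := by
    intro a b hab haQ p hp hpb
    have hab' : z b ≠ z a := fun h => hab.ne' (hD.inj h)
    set T := (fun t : ℝ => sidePt (z a) (z b) t 0) '' Ico 0 1 with hT
    have hTp : IsPreconnected T := isPreconnected_sidePt_image _ _ isPreconnected_Ico
    have haT : z a ∈ T := ⟨0, by simp, sidePt_zero _ _⟩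
    have hpT : p ∈ T := by
      rw [segment_eq_sidePt] at hp
      obtain ⟨t, ht, rfl⟩ := hp
      refine ⟨t, ⟨ht.1, ht.2.lt_of_ne ?_⟩, rfl⟩
      rintro rfl
      exact hpb (sidePt_one _ _)
    have hTJ : Disjoint T J := by
      rw [disjoint_left]
      rintro _ ⟨t, ht, rfl⟩ hJ
      have h1 := hJe a b hab haQ _ (sidePt_mem_segment ⟨ht.1, ht.2.le⟩) hJ
      simp only [sidePt, Complex.ofReal_zero, zero_mul, add_zero] at h1
      have h2 : ((t : ℂ) - 1) * (z b - z a) = 0 := by linear_combination h1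
      rcases mul_eq_zero.1 h2 with h3 | h3
      · exact ht.2.ne (by exact_mod_cast sub_eq_zero.1 h3)
      · exact hab' (sub_eq_zero.1 h3)
    exact ⟨fun h => hsubC T hTp hTJ ⟨p, h, hpT⟩ haT, fun h => hsubC T hTp hTJ ⟨_, h, haT⟩ hpT⟩
  refine ⟨{y | z y ∈ C}, {y | y ∉ Q ∧ z y ∉ C}, ?_, ?_, ?_, ?_, ?_, ?_, ?_⟩
  · exact disjoint_left.2 fun y h1 h2 => h2.2 h1
  · intro y
    simp only [mem_ofPred_eq, not_and, not_not]
    constructor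
    · intro h
      exact ⟨fun hy => disjoint_left.1 hCJ hy ((hJQ y).2 h), fun h' => absurd h h'⟩
    · intro h
      by_contra hy
      exact h.1 (h.2 hy)
  · rintro a ha b ⟨hbQ, hb⟩ hab
    refine hb (((hedge b a hab.symm hbQ (sidePt (z b) (z a) 2⁻¹ 0)
      (sidePt_mem_segment (by norm_num)) ?_)).1 ?_)
    · intro h
      simp only [sidePt] at h
      have h2 : (z a - z b) = 0 := by push_cast at h; linear_combination -2 * h
      exact hab.ne (hD.inj (sub_eq_zero.1 h2))
    · have haQ : a ∉ Q := fun h => disjoint_left.1 hCJ ha ((hJQ a).2 h)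
      refine (hedge a b hab haQ _ ?_ ?_).2 ha
      · rw [segment_symm]; exact sidePt_mem_segment (by norm_num)
      · intro h
        simp only [sidePt] at h
        have h2 : (z a - z b) = 0 := by push_cast at h; linear_combination 2 * h
        exact hab.ne (hD.inj (sub_eq_zero.1 h2))
  · refine subset_faceOn hN ⟨n0, hn0, faceOn_anti (subset_univ _) hn0F⟩ ?_
    have key : ∀ a b, G.Adj a b → a ∉ Q → z a ∉ C → z b ∉ C → ∀ p ∈ segment ℝ (z a) (z b),
        p ∉ C := by
      intro a b hab haQ ha hb p hp hpC
      have hpb : p ≠ z b := by rintro rfl; exact hb hpC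
      exact ha ((hedge a b hab haQ p hp hpb).1 hpC)
    rintro p hp (⟨a, ha, rfl⟩ | ⟨a, ha, b, hb, hab, hpab⟩)
    · exact ha (hNC hp)
    · by_cases haQ : a ∈ Q
      · by_cases hbQ : b ∈ Q
        · exact disjoint_left.1 hNJ hp (hJe' a haQ b hbQ hab hpab)
        · rw [segment_symm] at hpab
          exact key b a hab.symm hbQ hb ha p hpab (hNC hp)
      · exact key a b hab haQ ha hb p hpab (hNC hp)
  · refine subset_faceOn hN' ⟨n1, hn1, faceOn_anti (subset_univ _) hn1F⟩ ?_
    have hB : ∀ y, y ∉ {y | y ∉ Q ∧ z y ∉ C} → z y ∉ N' := by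
      intro y hy hyN
      by_cases hyQ : y ∈ Q
      · exact disjoint_left.1 hNJ' hyN ((hJQ y).2 hyQ)
      · exact hy ⟨hyQ, disjoint_left.1 hN'C hyN⟩
    have key : ∀ a b, G.Adj a b → a ∉ Q → a ∉ {y | y ∉ Q ∧ z y ∉ C} →
        b ∉ {y | y ∉ Q ∧ z y ∉ C} → ∀ p ∈ segment ℝ (z a) (z b), p ∉ N' := by
      intro a b hab haQ ha hb p hp hpN
      have hpb : p ≠ z b := by rintro rfl; exact hB b hb hpN
      refine disjoint_left.1 hN'C hpN ((hedge a b hab haQ p hp hpb).2 ?_)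
      by_contra h
      exact ha ⟨haQ, h⟩
    rintro p hp (⟨a, ha, rfl⟩ | ⟨a, ha, b, hb, hab, hpab⟩)
    · exact hB a ha hp
    · by_cases haQ : a ∈ Q
      · by_cases hbQ : b ∈ Q
        · exact disjoint_left.1 hNJ' hp (hJe' a haQ b hbQ hab hpab)
        · rw [segment_symm] at hpab
          exact key b a hab.symm hbQ hb ha p hpab hp
      · exact key a b hab haQ ha hb p hpab hp
  · intro T hT hTJ hNT y hy
    exact hsubC T hT hTJ (hNT.mono (inter_subset_inter_left _ hNC)) hy
  · intro T hT hTJ hNT y hy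
    refine ⟨fun h => disjoint_left.1 hTJ hy ((hJQ y).2 h), fun h => ?_⟩
    obtain ⟨p, hp, hpT⟩ := hNT
    exact disjoint_left.1 hN'C hp (hsubC T hT hTJ ⟨_, h, hy⟩ hpT)

end Face

lemma angleFrom_polarPt {v a : ℂ} (hav : a ≠ v) {ρ γ : ℝ} (hρ : 0 < ρ)
    (hγ : γ ∈ Ioc 0 (2 * Real.pi)) : angleFrom v a (polarPt v a ρ γ) = γ := by
  have hd := sub_ne_zero.2 hav
  have h : -((polarPt v a ρ γ - v) / (a - v)) =
      ρ * (Complex.cos ((γ - Real.pi : ℝ)) + Complex.sin ((γ - Real.pi : ℝ)) * Complex.I) := by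
    rw [← Complex.exp_mul_I]
    simp only [polarPt]
    push_cast
    rw [sub_mul, Complex.exp_sub, Complex.exp_pi_mul_I]
    field_simp
    ring
  unfold angleFrom
  rw [h, Complex.arg_mul_cos_add_sin_mul_I hρ ⟨by linarith [hγ.1], by linarith [hγ.2]⟩]
  ring

section Splits

variable {V : Type} {G : SimpleGraph V} {z : V → ℂ} {q : ℂ}

lemma isPreconnected_ioc_side (a b : ℂ) :
    IsPreconnected ((fun t : ℝ => sidePt a b t 0) '' Ioc 0 1) :=
  isPreconnected_sidePt_image _ _ isPreconnected_Ioc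

lemma IsDrawing.dir_ne (hD : IsDrawing G z) {x u v : V} (hv : G.Adj x v) (hu : G.Adj x u)
    (huv : v ≠ u) (t : ℝ) (ht : 0 < t) : z v - z x ≠ t * (z u - z x) := by
  intro h
  have ht0 : (t : ℂ) ≠ 0 := by exact_mod_cast ht.ne'
  rcases le_or_gt t 1 with h1 | h1
  · refine hD.off hu hv.ne' huv ?_
    have : z v = sidePt (z x) (z u) t 0 := by
      simp only [sidePt]; push_cast; linear_combination h
    rw [this]; exact sidePt_mem_segment ⟨ht.le, h1⟩
  · refine hD.off hv hu.ne' huv.symm ?_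
    have : z u = sidePt (z x) (z v) t⁻¹ 0 := by
      simp only [sidePt]; push_cast; field_simp; linear_combination -h
    rw [this]; exact sidePt_mem_segment ⟨by positivity, inv_le_one_of_one_le₀ h1.le⟩

lemma edge_notMem_faceOn {a b : V} (hab : G.Adj a b) {p : ℂ}
    (hp : p ∈ segment ℝ (z a) (z b)) : p ∉ faceOn G z q univ :=
  fun h => notMem_of_mem_faceOn h (Or.inr ⟨a, mem_univ a, b, mem_univ b, hab, hp⟩)

lemma vertex_notMem_faceOn (a : V) : z a ∉ faceOn G z q univ :=
  fun h => notMem_of_mem_faceOn h (Or.inl ⟨a, mem_univ a, rfl⟩)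

lemma access_dir {v x : V} (hvx : G.Adj v x) {s : ℂ}
    (hs : ∀ t ∈ Ioc (0 : ℝ) 1, sidePt (z v) s t 0 ∈ faceOn G z q univ) (t : ℝ) (ht : 0 < t) :
    s - z v ≠ t * (z x - z v) := by
  intro h
  have hm : 0 < min 1 t⁻¹ := by positivity
  refine edge_notMem_faceOn hvx ?_ (hs (min 1 t⁻¹) ⟨hm, min_le_left _ _⟩)
  have : sidePt (z v) s (min 1 t⁻¹) 0 = sidePt (z v) (z x) (min 1 t⁻¹ * t) 0 := by
    simp only [sidePt]; push_cast; rw [h]; ring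
  rw [this]
  refine sidePt_mem_segment ⟨by positivity, ?_⟩
  calc min 1 t⁻¹ * t ≤ t⁻¹ * t := by gcongr; exact min_le_right _ _
    _ = 1 := inv_mul_cancel₀ ht.ne'

lemma access_segment {a s : ℂ} {F : Set ℂ} (h : ∀ t ∈ Ioc (0 : ℝ) 1, sidePt a s t 0 ∈ F) {p : ℂ}
    (hp : p ∈ segment ℝ a s) : p = a ∨ p ∈ F := by
  rw [segment_eq_sidePt] at hp
  obtain ⟨t, ht, rfl⟩ := hp
  rcases ht.1.eq_or_lt with h0 | h0
  · left; simp [← h0, sidePt]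
  · exact Or.inr (h t ⟨h0, ht.2⟩)

lemma exists_access_point [Finite V] (hD : IsDrawing G z) {v : V}
    (hv : z v ∈ closure (faceOn G z q univ)) :
    ∃ s ∈ faceOn G z q univ, ∀ t ∈ Ioc (0 : ℝ) 1, sidePt (z v) s t 0 ∈ faceOn G z q univ := by
  obtain ⟨r, hr, -, h⟩ := exists_access (q := q) hD v
  obtain ⟨s, hs, hd⟩ := Metric.mem_closure_iff.1 hv r hr
  exact ⟨s, hs, h s hs (by rwa [dist_comm])⟩

lemma sidePt_ne_right {a b : ℂ} (hab : a ≠ b) {t : ℝ} (ht : t ≠ 1) : sidePt a b t 0 ≠ b := by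
  intro h
  simp only [sidePt] at h
  have h2 : ((t : ℂ) - 1) * (b - a) = 0 := by push_cast at h; linear_combination h
  rcases mul_eq_zero.1 h2 with h3 | h3
  · exact ht (by exact_mod_cast sub_eq_zero.1 h3)
  · exact hab (sub_eq_zero.1 h3).symm

lemma sidePt_ne_left {a b : ℂ} (hab : a ≠ b) {t : ℝ} (ht : t ≠ 0) : sidePt a b t 0 ≠ a := by
  intro h
  simp only [sidePt] at h
  have h2 : (t : ℂ) * (b - a) = 0 := by push_cast at h; linear_combination h
  rcases mul_eq_zero.1 h2 with h3 | h3
  · exact ht (by exact_mod_cast h3)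
  · exact hab (sub_eq_zero.1 h3).symm

/-- Splitting along an edge both of whose ends lie on the face. -/
theorem split_edge [Finite V] (hD : IsDrawing G z) {v x : V} (hvx : G.Adj v x)
    (hv : z v ∈ closure (faceOn G z q univ)) (hx : z x ∈ closure (faceOn G z q univ)) :
    ∃ A B : Set V, Disjoint A B ∧ (∀ y, y = v ∨ y = x ↔ y ∉ A ∧ y ∉ B) ∧
      (∀ a ∈ A, ∀ b ∈ B, ¬ G.Adj a b) ∧
      segment ℝ (z v) (z x) ⊆ closure (faceOn G z q Aᶜ) ∧
      segment ℝ (z v) (z x) ⊆ closure (faceOn G z q Bᶜ) := by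
  set F := faceOn G z q univ with hF
  have hFo : IsOpen F := isOpen_faceOn univ
  obtain ⟨s, hs, hsF⟩ := exists_access_point hD hv
  obtain ⟨s', hs', hsF'⟩ := exists_access_point hD hx
  obtain ⟨K, hKF, hKc, -, hK⟩ := exists_hasAngleLift hFo (isPreconnected_faceOn univ) hs' hs
  have hRF : ∀ p ∈ segment ℝ (z x) s' ∪ K, p = z x ∨ p ∈ F := by
    rintro p (hp | hp)
    · exact access_segment hsF' hp
    · exact Or.inr (hKF hp)
  have hzvx : z x ≠ z v := fun h => hvx.ne' (hD.inj h)
  set J := segment ℝ (z v) s ∪ segment ℝ (z v) (z x) ∪ (segment ℝ (z x) s' ∪ K) with hJ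
  have hJF : ∀ p ∈ J, p ∈ F ∨ p ∈ segment ℝ (z v) (z x) := by
    rintro p ((hp | hp) | hp)
    · rcases access_segment hsF hp with rfl | h
      · exact Or.inr (left_mem_segment _ _ _)
      · exact Or.inl h
    · exact Or.inr hp
    · rcases hRF p hp with rfl | h
      · exact Or.inr (right_mem_segment _ _ _)
      · exact Or.inl h
  obtain ⟨N, N', n1, m1, n2, m2, n3, m3, n4, m4, -, hsep⟩ := exists_sides (v := z v) (x := z x)
    (s := s) (R := segment ℝ (z x) s' ∪ K) (F := F)
    ((isCompact_segment _ _).isClosed.union hKc.isClosed)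
    ((hasAngleLift_segment (z x) s').trans hK)
    (fun h => (hRF _ h).elim hzvx.symm (vertex_notMem_faceOn v))
    (Or.inl (left_mem_segment _ _ _)) hzvx (fun h => vertex_notMem_faceOn v (h ▸ hs))
    (access_dir hvx hsF)
    (fun ε hε h => (hRF _ h).elim (sidePt_ne_right hzvx.symm hε.2.ne)
      (edge_notMem_faceOn hvx (sidePt_mem_segment ⟨hε.1.le, hε.2.le⟩))) hFo hsF
  have e1 : ∀ y, z y ∈ J ↔ y ∈ ({v, x} : Set V) := by
    intro y
    constructor
    · intro h
      by_contra hy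
      simp only [mem_insert_iff, mem_singleton_iff, not_or] at hy
      rcases hJF _ h with h | h
      · exact vertex_notMem_faceOn y h
      · exact hD.off hvx hy.1 hy.2 h
    · rintro (rfl | rfl)
      · exact Or.inl (Or.inl (left_mem_segment _ _ _))
      · exact Or.inl (Or.inr (right_mem_segment _ _ _))
  have e2 : ∀ a b, G.Adj a b → a ∉ ({v, x} : Set V) → ∀ p ∈ segment ℝ (z a) (z b),
      p ∈ J → p = z b := by
    intro a b hab ha p hp hpJ
    simp only [mem_insert_iff, mem_singleton_iff, not_or] at ha
    rcases hJF _ hpJ with h | h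
    · exact absurd h (edge_notMem_faceOn hab hp)
    · have := hD.meet hab hvx (by
        intro he; rw [Sym2.eq_iff] at he; rcases he with h | h
        exacts [ha.1 h.1, ha.2 h.1]) ⟨hp, h⟩
      rcases this.1 with h1 | h1
      · rcases this.2 with h2 | h2
        · exact absurd (hD.inj (h1.symm.trans h2)) ha.1
        · exact absurd (hD.inj (h1.symm.trans h2)) ha.2
      · exact h1
  have e3 : ∀ a ∈ ({v, x} : Set V), ∀ b ∈ ({v, x} : Set V), G.Adj a b →
      segment ℝ (z a) (z b) ⊆ J := by
    intro a ha b hb hab p hp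
    simp only [mem_insert_iff, mem_singleton_iff] at ha hb
    refine Or.inl (Or.inr ?_)
    rcases ha with rfl | rfl <;> rcases hb with rfl | rfl
    · exact absurd rfl hab.ne
    · exact hp
    · rwa [segment_symm]
    · exact absurd rfl hab.ne
  obtain ⟨A, B, h1, h2, h3, h4, h5, -, -⟩ := split_of_separated hD e1 e2 e3 n1 m1 n2 m2 n3 m3 hsep
  exact ⟨A, B, h1, fun y => by simpa using h2 y, h3, n4.trans (closure_mono h4),
    m4.trans (closure_mono h5)⟩

/-- Splitting along a path of length two both of whose ends lie on the face. -/
theorem split_path [Finite V] (hD : IsDrawing G z) {v x u : V} (hvx : G.Adj v x)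
    (hxu : G.Adj x u) (huv : v ≠ u) (hvu : ¬ G.Adj v u)
    (hv : z v ∈ closure (faceOn G z q univ)) (hu : z u ∈ closure (faceOn G z q univ)) :
    ∃ A B : Set V, Disjoint A B ∧ (∀ y, y = v ∨ y = x ∨ y = u ↔ y ∉ A ∧ y ∉ B) ∧
      (∀ a ∈ A, ∀ b ∈ B, ¬ G.Adj a b) ∧
      segment ℝ (z v) (z x) ⊆ closure (faceOn G z q Aᶜ) ∧
      segment ℝ (z x) (z u) ⊆ closure (faceOn G z q Aᶜ) ∧
      segment ℝ (z v) (z x) ⊆ closure (faceOn G z q Bᶜ) ∧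
      segment ℝ (z x) (z u) ⊆ closure (faceOn G z q Bᶜ) := by
  set F := faceOn G z q univ with hF
  have hFo : IsOpen F := isOpen_faceOn univ
  obtain ⟨s, hs, hsF⟩ := exists_access_point hD hv
  obtain ⟨s', hs', hsF'⟩ := exists_access_point hD hu
  obtain ⟨K, hKF, hKc, -, hK⟩ := exists_hasAngleLift hFo (isPreconnected_faceOn univ) hs' hs
  have hRF : ∀ p ∈ segment ℝ (z u) s' ∪ K, p = z u ∨ p ∈ F := by
    rintro p (hp | hp)
    · exact access_segment hsF' hp
    · exact Or.inr (hKF hp)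
  have hzvx : z x ≠ z v := fun h => hvx.ne' (hD.inj h)
  have hzux : z u ≠ z x := fun h => hxu.ne' (hD.inj h)
  have hzuv : z v ≠ z u := fun h => huv (hD.inj h)
  have hedges : s(v, x) ≠ s(x, u) := by
    intro he; rw [Sym2.eq_iff] at he; rcases he with h | h
    exacts [hvx.ne h.1, huv h.1]
  set J := segment ℝ (z v) s ∪ segment ℝ (z v) (z x) ∪
    (segment ℝ (z x) (z u) ∪ (segment ℝ (z u) s' ∪ K)) with hJ
  have hJF : ∀ p ∈ J, p ∈ F ∨ p ∈ segment ℝ (z v) (z x) ∨ p ∈ segment ℝ (z x) (z u) := by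
    rintro p ((hp | hp) | (hp | hp))
    · rcases access_segment hsF hp with rfl | h
      · exact Or.inr (Or.inl (left_mem_segment _ _ _))
      · exact Or.inl h
    · exact Or.inr (Or.inl hp)
    · exact Or.inr (Or.inr hp)
    · rcases hRF p hp with rfl | h
      · exact Or.inr (Or.inr (right_mem_segment _ _ _))
      · exact Or.inl h
  have hJ2 : J = segment ℝ (z x) (z v) ∪ segment ℝ (z x) (z u) ∪
      (segment ℝ (z v) s ∪ (segment ℝ (z u) s' ∪ K)) := by
    rw [hJ, segment_symm ℝ (z v) (z x)]
    ext p; simp only [mem_union]; tauto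
  have hRc : IsClosed (segment ℝ (z u) s' ∪ K) :=
    (isCompact_segment _ _).isClosed.union hKc.isClosed
  obtain ⟨N, N', n1, m1, n2, m2, n3, m3, n4, m4, n5, hsep⟩ := exists_sides (v := z v) (x := z x)
    (s := s) (R := segment ℝ (z x) (z u) ∪ (segment ℝ (z u) s' ∪ K)) (F := F)
    ((isCompact_segment _ _).isClosed.union hRc)
    ((hasAngleLift_segment (z x) (z u)).trans ((hasAngleLift_segment (z u) s').trans hK))
    (by
      rintro (h | h)
      · exact hD.off hxu hvx.ne huv h
      · exact (hRF _ h).elim hzuv (vertex_notMem_faceOn v))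
    (Or.inl (left_mem_segment _ _ _)) hzvx (fun h => vertex_notMem_faceOn v (h ▸ hs))
    (access_dir hvx hsF)
    (by
      rintro ε hε (h | h)
      · have := hD.meet hvx hxu hedges ⟨sidePt_mem_segment ⟨hε.1.le, hε.2.le⟩, h⟩
        rcases this.1 with h1 | h1
        · exact sidePt_ne_left hzvx.symm hε.1.ne' h1
        · exact sidePt_ne_right hzvx.symm hε.2.ne h1
      · rcases hRF _ h with h1 | h1
        · exact hD.off hvx huv.symm hxu.ne' (h1 ▸ sidePt_mem_segment ⟨hε.1.le, hε.2.le⟩)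
        · exact edge_notMem_faceOn hvx (sidePt_mem_segment ⟨hε.1.le, hε.2.le⟩) h1) hFo hsF
  have hR2 : ∀ p ∈ segment ℝ (z v) s ∪ (segment ℝ (z u) s' ∪ K), p = z v ∨ p = z u ∨ p ∈ F := by
    rintro p (hp | hp)
    · exact (access_segment hsF hp).imp id Or.inr
    · exact Or.inr (hRF p hp)
  have hR2c : IsClosed (segment ℝ (z v) s ∪ (segment ℝ (z u) s' ∪ K)) :=
    (isCompact_segment _ _).isClosed.union hRc
  have hdir := hD.dir_ne hvx.symm hxu huv
  have hxR2 : z x ∉ segment ℝ (z v) s ∪ (segment ℝ (z u) s' ∪ K) := fun h => by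
    rcases hR2 _ h with h | h | h
    exacts [hzvx h, hzux h.symm, vertex_notMem_faceOn x h]
  have huo : ∀ ε ∈ Ioo (0 : ℝ) 1,
      sidePt (z x) (z u) ε 0 ∉ segment ℝ (z v) s ∪ (segment ℝ (z u) s' ∪ K) := by
    intro ε hε h
    have hmem := sidePt_mem_segment (a := z x) (b := z u) ⟨hε.1.le, hε.2.le⟩
    rcases hR2 _ h with h | h | h
    · rw [h] at hmem
      exact hD.off hxu hvx.ne huv hmem
    · exact sidePt_ne_right hzux.symm hε.2.ne h
    · exact edge_notMem_faceOn hxu hmem h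
  obtain ⟨M, k1, k2, k3, k4⟩ := extend_side hR2c hzvx.symm hzux hdir hxR2 huo n1 (hJ2 ▸ n2)
    (fun ε hε => (n5 ε hε).mono fun _ h => h.1)
  obtain ⟨M', l1, l2, l3, l4⟩ := extend_side' hR2c hzvx.symm hzux hdir hxR2 huo m1 (hJ2 ▸ m2)
    (fun ε hε => (n5 ε hε).mono fun _ h => h.2)
  rw [← hJ2] at k3 l3
  have e1 : ∀ y, z y ∈ J ↔ y ∈ ({v, x, u} : Set V) := by
    intro y
    constructor
    · intro h
      by_contra hy
      simp only [mem_insert_iff, mem_singleton_iff, not_or] at hy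
      rcases hJF _ h with h | h | h
      · exact vertex_notMem_faceOn y h
      · exact hD.off hvx hy.1 hy.2.1 h
      · exact hD.off hxu hy.2.1 hy.2.2 h
    · rintro (rfl | rfl | rfl)
      · exact Or.inl (Or.inl (left_mem_segment _ _ _))
      · exact Or.inl (Or.inr (right_mem_segment _ _ _))
      · exact Or.inr (Or.inl (right_mem_segment _ _ _))
  have e2 : ∀ a b, G.Adj a b → a ∉ ({v, x, u} : Set V) → ∀ p ∈ segment ℝ (z a) (z b),
      p ∈ J → p = z b := by
    intro a b hab ha p hp hpJ
    simp only [mem_insert_iff, mem_singleton_iff, not_or] at ha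
    have key : ∀ c d, G.Adj c d → a ≠ c → a ≠ d → p ∈ segment ℝ (z c) (z d) → p = z b := by
      intro c d hcd hac had h
      have := hD.meet hab hcd (by
        intro he; rw [Sym2.eq_iff] at he; rcases he with h | h
        exacts [hac h.1, had h.1]) ⟨hp, h⟩
      rcases this.1 with h1 | h1
      · rcases this.2 with h2 | h2
        · exact absurd (hD.inj (h1.symm.trans h2)) hac
        · exact absurd (hD.inj (h1.symm.trans h2)) had
      · exact h1
    rcases hJF _ hpJ with h | h | h
    · exact absurd h (edge_notMem_faceOn hab hp)
    · exact key v x hvx ha.1 ha.2.1 h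
    · exact key x u hxu ha.2.1 ha.2.2 h
  have e3 : ∀ a ∈ ({v, x, u} : Set V), ∀ b ∈ ({v, x, u} : Set V), G.Adj a b →
      segment ℝ (z a) (z b) ⊆ J := by
    intro a ha b hb hab p hp
    simp only [mem_insert_iff, mem_singleton_iff] at ha hb
    rcases ha with rfl | rfl | rfl <;> rcases hb with rfl | rfl | rfl
    · exact absurd rfl hab.ne
    · exact Or.inl (Or.inr hp)
    · exact absurd hab hvu
    · rw [segment_symm] at hp; exact Or.inl (Or.inr hp)
    · exact absurd rfl hab.ne
    · exact Or.inr (Or.inl hp)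
    · exact absurd hab.symm hvu
    · rw [segment_symm] at hp; exact Or.inr (Or.inl hp)
    · exact absurd rfl hab.ne
  obtain ⟨A, B, h1, h2, h3, h4, h5, -, -⟩ := split_of_separated hD e1 e2 e3 k2 l2 k3 l3
    (n3.mono (inter_subset_inter_left _ k1)) (m3.mono (inter_subset_inter_left _ l1))
    (fun T t1 t2 t3 t4 => hsep T t1 t2 (k1.trans t3) (l1.trans t4))
  exact ⟨A, B, h1, fun y => by simpa using h2 y, h3,
    n4.trans (closure_mono (k1.trans h4)), k4.trans (closure_mono h4),
    m4.trans (closure_mono (l1.trans h5)), l4.trans (closure_mono h5)⟩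

end Splits

section ThreeEdges

variable {V : Type} {G : SimpleGraph V} {z : V → ℂ} {q : ℂ}

lemma sidePt_polarPt (v a : ℂ) (ρ γ t : ℝ) :
    sidePt v (polarPt v a ρ γ) t 0 = polarPt v a (t * ρ) γ := by
  rw [← polarPt_zero_angle, polarPt_polarPt, zero_add]

lemma angleFrom_sidePt {v a y : ℂ} (hav : a ≠ v) (hy : y ≠ v) {t : ℝ} (ht : 0 < t) :
    angleFrom v a (sidePt v y t 0) = angleFrom v a y := by
  have h := polarPt_angleFrom hav y
  have hρ : 0 < ‖y - v‖ / ‖a - v‖ :=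
    div_pos (norm_pos_iff.2 (sub_ne_zero.2 hy)) (norm_pos_iff.2 (sub_ne_zero.2 hav))
  conv_lhs => rw [← h, sidePt_polarPt]
  exact angleFrom_polarPt hav (mul_pos ht hρ) ⟨angleFrom_pos _ _ _, angleFrom_le _ _ _⟩

lemma eq_smul_of_angleFrom_eq {v a y y' : ℂ} (hav : a ≠ v) (hy : y ≠ v) (hy' : y' ≠ v)
    (h : angleFrom v a y = angleFrom v a y') : ∃ t : ℝ, 0 < t ∧ y - v = t * (y' - v) := by
  have h1 := polarPt_angleFrom hav y
  have h2 := polarPt_angleFrom hav y'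
  have hn : 0 < ‖y - v‖ := norm_pos_iff.2 (sub_ne_zero.2 hy)
  have hn' : 0 < ‖y' - v‖ := norm_pos_iff.2 (sub_ne_zero.2 hy')
  have ha : 0 < ‖a - v‖ := norm_pos_iff.2 (sub_ne_zero.2 hav)
  refine ⟨‖y - v‖ / ‖y' - v‖, div_pos hn hn', ?_⟩
  rw [h] at h1
  generalize angleFrom v a y' = γ at h1 h2
  simp only [polarPt] at h1 h2
  have e1 : (‖y' - v‖ : ℂ) ≠ 0 := by exact_mod_cast hn'.ne'
  have e2 : (‖a - v‖ : ℂ) ≠ 0 := by exact_mod_cast ha.ne'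
  have h1' := sub_eq_iff_eq_add'.2 h1.symm
  have h2' := sub_eq_iff_eq_add'.2 h2.symm
  calc y - v = _ := h1'
    _ = (‖y - v‖ / ‖y' - v‖ : ℝ) *
        ((‖y' - v‖ / ‖a - v‖ : ℝ) * Complex.exp (γ * Complex.I) * (a - v)) := by
      push_cast; field_simp
    _ = _ := by rw [← h2']

lemma continuousAt_angleFrom {v a y : ℂ} (hav : a ≠ v) (hy : y ≠ v)
    (h : ∀ t : ℝ, 0 < t → y - v ≠ t * (a - v)) : ContinuousAt (angleFrom v a) y := by
  unfold angleFrom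
  refine ContinuousAt.add ?_ continuousAt_const
  refine (Complex.continuousAt_arg (neg_div_mem_slitPlane hav hy h)).comp
    (f := fun y => -((y - v) / (a - v))) ?_
  fun_prop

open Filter Topology in
lemma three_edges_aux [Finite V] (hD : IsDrawing G z) {v a b c : V} {s : ℂ}
    (hva : G.Adj v a) (hvb : G.Adj v b) (hvc : G.Adj v c)
    (hs : s ∈ faceOn G z q univ)
    (hsF : ∀ t ∈ Ioc (0 : ℝ) 1, sidePt (z v) s t 0 ∈ faceOn G z q univ)
    (hab : angleFrom (z v) s (z a) < angleFrom (z v) s (z b))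
    (hbc : angleFrom (z v) s (z b) < angleFrom (z v) s (z c))
    (hb : segment ℝ (z v) (z b) ⊆ closure (faceOn G z q univ)) :
    ∃ A B : Set V, Disjoint A B ∧ (∀ y, y = v ↔ y ∉ A ∧ y ∉ B) ∧
      (∀ a ∈ A, ∀ b ∈ B, ¬ G.Adj a b) ∧ a ∈ A ∧ c ∈ B := by
  set F := faceOn G z q univ with hF
  have hFo : IsOpen F := isOpen_faceOn univ
  have hne : ∀ y, G.Adj v y → z y ≠ z v := fun y hy h => hy.ne' (hD.inj h)
  have hsv : s ≠ z v := fun h => vertex_notMem_faceOn v (h ▸ hs)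
  have hdir : ∀ y, G.Adj v y → ∀ t : ℝ, 0 < t → z y - z v ≠ t * (s - z v) :=
    fun y hy => dir_symm (access_dir hy hsF)
  have hc2 : angleFrom (z v) s (z c) < 2 * Real.pi := angleFrom_lt hsv (hne c hvc) (hdir c hvc)
  obtain ⟨r, hr, -, hacc⟩ := exists_access (q := q) hD v
  have hbv := hne b hvb
  have hd : 0 < dist (z b) (z v) := dist_pos.2 hbv
  set ε := min 1 (r / (2 * dist (z b) (z v))) with hε
  have hε0 : 0 < ε := by positivity
  set m := sidePt (z v) (z b) ε 0 with hm
  have hmF : m ∈ closure F := hb (sidePt_mem_segment ⟨hε0.le, min_le_left _ _⟩)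
  have hmr : dist m (z v) < r := by
    rw [hm, dist_sidePt, abs_of_pos hε0]
    calc ε * dist (z b) (z v) ≤ r / (2 * dist (z b) (z v)) * dist (z b) (z v) := by
          gcongr; exact min_le_right _ _
      _ = r / 2 := by field_simp
      _ < r := by linarith
  have hmv : m ≠ z v := sidePt_ne_left hbv.symm hε0.ne'
  have hmang : angleFrom (z v) s m = angleFrom (z v) s (z b) := angleFrom_sidePt hsv hbv hε0
  have hmdir : ∀ t : ℝ, 0 < t → m - z v ≠ t * (s - z v) := by
    intro t ht h
    have h' : m = polarPt (z v) s t (2 * Real.pi) := by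
      have := polarPt_two_pi (z v) s t 0
      rw [zero_add] at this
      rw [this, polarPt_zero_angle]
      simp only [sidePt]; push_cast; linear_combination h
    rw [h', angleFrom_polarPt hsv ht ⟨by positivity, le_rfl⟩] at hmang
    linarith
  have hnear : ∀ᶠ p in 𝓝 m, dist p (z v) < r ∧ angleFrom (z v) s (z a) < angleFrom (z v) s p ∧
      angleFrom (z v) s p < angleFrom (z v) s (z c) := by
    have hca := continuousAt_angleFrom hsv hmv hmdir
    have h1 : ∀ᶠ p in 𝓝 m, dist p (z v) < r :=
      (continuous_id.dist continuous_const).continuousAt.eventually_lt continuousAt_const hmr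
    have h2 := continuousAt_const.eventually_lt hca (hmang ▸ hab)
    have h3 := hca.eventually_lt continuousAt_const (hmang ▸ hbc)
    filter_upwards [h1, h2, h3] with p a1 a2 a3 using ⟨a1, a2, a3⟩
  obtain ⟨p, ⟨hpr, hap, hpc⟩, hpF⟩ := mem_closure_iff_nhds.1 hmF _ hnear
  have hpv : p ≠ z v := fun h => vertex_notMem_faceOn v (h ▸ hpF)
  have hpacc := hacc p hpF hpr
  obtain ⟨K, hKF, hKc, -, hK⟩ := exists_hasAngleLift hFo (isPreconnected_faceOn univ) hs hpF
  have hpdir : ∀ t : ℝ, 0 < t → p - z v ≠ t * (s - z v) := by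
    intro t ht h
    have h' : p = polarPt (z v) s t (2 * Real.pi) := by
      have := polarPt_two_pi (z v) s t 0
      rw [zero_add] at this
      rw [this, polarPt_zero_angle]
      simp only [sidePt]; push_cast; linear_combination h
    rw [h', angleFrom_polarPt hsv ht ⟨by positivity, le_rfl⟩] at hpc
    linarith
  obtain ⟨N, N', n1, m1, n2, m2, n3, m3, ⟨e, he, n4⟩, ⟨e', he', m4⟩, -, hsep⟩ :=
    exists_sectors hKc.isClosed hK (fun h => vertex_notMem_faceOn v (hKF h)) hsv hpv hpdir hFo
      hpacc
  set J := segment ℝ (z v) p ∪ segment ℝ (z v) s ∪ K with hJ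
  have hJF : ∀ x ∈ J, x = z v ∨ x ∈ F := by
    rintro x ((h | h) | h)
    · exact access_segment hpacc h
    · exact access_segment hsF h
    · exact Or.inr (hKF h)
  have e1 : ∀ y, z y ∈ J ↔ y ∈ ({v} : Set V) := by
    intro y
    constructor
    · intro h
      exact hD.inj ((hJF _ h).resolve_right (vertex_notMem_faceOn y))
    · rintro rfl
      exact Or.inl (Or.inl (left_mem_segment _ _ _))
  have e2 : ∀ a b, G.Adj a b → a ∉ ({v} : Set V) → ∀ p ∈ segment ℝ (z a) (z b),
      p ∈ J → p = z b := by
    intro a b hab ha p hp hpJ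
    have hpv := (hJF p hpJ).resolve_right (edge_notMem_faceOn hab hp)
    by_contra hpb
    rw [hpv] at hp hpb
    exact hD.off hab (fun h => ha h.symm) (fun h => hpb (by rw [h])) hp
  have e3 : ∀ a ∈ ({v} : Set V), ∀ b ∈ ({v} : Set V), G.Adj a b →
      segment ℝ (z a) (z b) ⊆ J := by
    rintro a rfl b rfl hab
    exact absurd rfl hab.ne
  obtain ⟨A, B, h1, h2, h3, -, -, h6, h7⟩ := split_of_separated hD e1 e2 e3 n1 m1 n2 m2 n3 m3 hsep
  have hTJ : ∀ y, G.Adj v y →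
      Disjoint ((fun t : ℝ => sidePt (z v) (z y) t 0) '' Ioc 0 1) J := by
    intro y hy
    rw [disjoint_left]
    rintro _ ⟨t, ht, rfl⟩ h
    rcases hJF _ h with h | h
    · exact sidePt_ne_left (hne y hy).symm ht.1.ne' h
    · exact edge_notMem_faceOn hy (sidePt_mem_segment ⟨ht.1.le, ht.2⟩) h
  have hTy : ∀ y, z y ∈ (fun t : ℝ => sidePt (z v) (z y) t 0) '' Ioc 0 1 :=
    fun y => ⟨1, by simp, sidePt_one _ _⟩
  have hpol := fun y => polarPt_angleFrom hsv y
  have hρ : ∀ y, y ≠ z v → 0 < ‖y - z v‖ / ‖s - z v‖ := fun y hy =>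
    div_pos (norm_pos_iff.2 (sub_ne_zero.2 hy)) (norm_pos_iff.2 (sub_ne_zero.2 hsv))
  refine ⟨A, B, h1, fun y => by simpa using h2 y, h3, ?_, ?_⟩
  · refine h6 _ (isPreconnected_ioc_side (z v) (z a)) (hTJ a hva) ?_ a (hTy a)
    have hρa := hρ _ (hne a hva)
    set ρ := ‖z a - z v‖ / ‖s - z v‖ with hρd
    obtain ⟨t, ht⟩ : ∃ t, t ∈ Ioo 0 (min 1 (e / ρ)) := nonempty_Ioo.2 (by positivity)
    refine ⟨sidePt (z v) (z a) t 0, ?_, t, ⟨ht.1, (ht.2.trans_le (min_le_left _ _)).le⟩, rfl⟩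
    rw [← hpol (z a), sidePt_polarPt]
    exact n4 _ ⟨mul_pos ht.1 hρa, (lt_div_iff₀ hρa).1 (ht.2.trans_le (min_le_right _ _))⟩ _
      ⟨angleFrom_pos _ _ _, hap⟩
  · refine h7 _ (isPreconnected_ioc_side (z v) (z c)) (hTJ c hvc) ?_ c (hTy c)
    have hρc := hρ _ (hne c hvc)
    have hρp := hρ _ hpv
    set ρ := ‖z c - z v‖ / ‖s - z v‖ with hρd
    set σ := ‖p - z v‖ / ‖s - z v‖ with hσd
    have htrans : ∀ τ γ, polarPt (z v) s τ γ =
        polarPt (z v) p (τ / σ) (γ - angleFrom (z v) s p) := by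
      intro τ γ
      conv_rhs => rw [← hpol p]
      rw [polarPt_polarPt, angleFrom_polarPt hsv hρp ⟨angleFrom_pos _ _ _, angleFrom_le _ _ _⟩]
      rw [div_mul_cancel₀ _ hρp.ne', sub_add_cancel]
    have hang : angleFrom (z v) p s = 2 * Real.pi - angleFrom (z v) s p := by
      have h0 : s = polarPt (z v) s 1 (0 + 2 * Real.pi) := by
        rw [polarPt_two_pi, polarPt_zero_angle, sidePt_one]
      rw [htrans, zero_add] at h0
      conv_lhs => rw [h0]
      exact angleFrom_polarPt hpv (by positivity)
        ⟨by linarith, by linarith [angleFrom_pos (z v) s p]⟩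
    obtain ⟨t, ht⟩ : ∃ t, t ∈ Ioo 0 (min 1 (e' / (ρ / σ))) := nonempty_Ioo.2 (by positivity)
    refine ⟨sidePt (z v) (z c) t 0, ?_, t, ⟨ht.1, (ht.2.trans_le (min_le_left _ _)).le⟩, rfl⟩
    rw [← hpol (z c), sidePt_polarPt, htrans]
    refine m4 _ ⟨by have := ht.1; positivity, ?_⟩ _ ⟨by linarith, by rw [hang]; linarith⟩
    have := (lt_div_iff₀ (div_pos hρc hρp)).1 (ht.2.trans_le (min_le_right _ _))
    rwa [mul_div_assoc]

/-- A vertex with three edges on the boundary of one face is a cut vertex. -/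
theorem three_edges [Finite V] (hD : IsDrawing G z) {v a b c : V}
    (hva : G.Adj v a) (hvb : G.Adj v b) (hvc : G.Adj v c) (hab : a ≠ b) (hbc : b ≠ c)
    (hac : a ≠ c)
    (ha : segment ℝ (z v) (z a) ⊆ closure (faceOn G z q univ))
    (hb : segment ℝ (z v) (z b) ⊆ closure (faceOn G z q univ))
    (hc : segment ℝ (z v) (z c) ⊆ closure (faceOn G z q univ)) :
    ∃ A B : Set V, Disjoint A B ∧ (∀ y, y = v ↔ y ∉ A ∧ y ∉ B) ∧
      (∀ a ∈ A, ∀ b ∈ B, ¬ G.Adj a b) ∧ A.Nonempty ∧ B.Nonempty := by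
  obtain ⟨s, hs, hsF⟩ := exists_access_point hD (ha (left_mem_segment _ _ _))
  have hsv : s ≠ z v := fun h => vertex_notMem_faceOn v (h ▸ hs)
  have hne : ∀ y, G.Adj v y → z y ≠ z v := fun y hy h => hy.ne' (hD.inj h)
  have hang : ∀ y y', G.Adj v y → G.Adj v y' → y ≠ y' →
      angleFrom (z v) s (z y) ≠ angleFrom (z v) s (z y') := by
    intro y y' hy hy' hyy h
    obtain ⟨t, ht, he⟩ := eq_smul_of_angleFrom_eq hsv (hne y hy) (hne y' hy') h
    exact hD.dir_ne hy hy' hyy t ht he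
  have key : ∀ y1 y2 y3, G.Adj v y1 → G.Adj v y2 → G.Adj v y3 →
      angleFrom (z v) s (z y1) < angleFrom (z v) s (z y2) →
      angleFrom (z v) s (z y2) < angleFrom (z v) s (z y3) →
      segment ℝ (z v) (z y2) ⊆ closure (faceOn G z q univ) →
      ∃ A B : Set V, Disjoint A B ∧ (∀ y, y = v ↔ y ∉ A ∧ y ∉ B) ∧
        (∀ a ∈ A, ∀ b ∈ B, ¬ G.Adj a b) ∧ A.Nonempty ∧ B.Nonempty := by
    intro y1 y2 y3 h1 h2 h3 h12 h23 hs2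
    obtain ⟨A, B, k1, k2, k3, k4, k5⟩ := three_edges_aux hD h1 h2 h3 hs hsF h12 h23 hs2
    exact ⟨A, B, k1, k2, k3, ⟨_, k4⟩, ⟨_, k5⟩⟩
  have gab := hang a b hva hvb hab
  have gbc := hang b c hvb hvc hbc
  have gac := hang a c hva hvc hac
  rcases gab.lt_or_gt with l1 | l1 <;> rcases gbc.lt_or_gt with l2 | l2 <;>
    rcases gac.lt_or_gt with l3 | l3
  · exact key a b c hva hvb hvc l1 l2 hb
  · exact key a b c hva hvb hvc l1 l2 hb
  · exact key a c b hva hvc hvb l3 l2 hc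
  · exact key c a b hvc hva hvb l3 l1 ha
  · exact key b a c hvb hva hvc l1 l3 ha
  · exact key b c a hvb hvc hva l2 l3 hc
  · exact key c b a hvc hvb hva l2 l1 hb
  · exact key c b a hvc hvb hva l2 l1 hb

end ThreeEdges

/-- The identification of the coordinate plane with `ℂ`. -/
noncomputable def planeToComplex : (ℝ × ℝ) ≃L[ℝ] ℂ := Complex.equivRealProdCLM.symm

lemma planeToComplex_image_seg (a b : ℝ × ℝ) :
    planeToComplex '' seg a b = segment ℝ (planeToComplex a) (planeToComplex b) :=
  image_segment ℝ planeToComplex.toLinearEquiv.toLinearMap.toAffineMap a b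

section Transfer

variable {V : Type} {G : SimpleGraph V}

/-- The position of a vertex as a complex number. -/
noncomputable def PlaneEmb.cpos (E : PlaneEmb G) (v : V) : ℂ := planeToComplex (E.pos v)

lemma PlaneEmb.isDrawing (E : PlaneEmb G) : IsDrawing G E.cpos where
  inj := planeToComplex.injective.comp E.inj
  meet := by
    intro a b c d hab hcd hne
    simp only [cpos]
    rw [← planeToComplex_image_seg, ← planeToComplex_image_seg,
      ← image_inter planeToComplex.injective]
    refine (image_mono (E.edges_meet hab hcd hne)).trans ?_
    rw [image_inter planeToComplex.injective, image_pair, image_pair]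
  off := by
    intro a b v hab h1 h2
    simp only [cpos]
    rw [← planeToComplex_image_seg, planeToComplex.injective.mem_set_image]
    exact E.vertex_off hab h1 h2

lemma PlaneEmb.image_drawing (E : PlaneEmb G) :
    planeToComplex '' E.drawing = drawOn G E.cpos univ := by
  ext p
  simp only [drawing, image_union, image_iUnion, planeToComplex_image_seg, drawOn, cpos,
    mem_union, mem_iUnion, mem_ofPred_eq, mem_univ, true_and, mem_image, mem_range,
    exists_exists_eq_and, exists_prop]

lemma PlaneEmb.image_face (E : PlaneEmb G) {q : ℝ × ℝ} (hq : q ∉ E.drawing) :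
    planeToComplex '' connectedComponentIn E.drawingᶜ q =
      faceOn G E.cpos (planeToComplex q) univ := by
  have h := planeToComplex.toHomeomorph.image_connectedComponentIn (s := E.drawingᶜ) hq
  have h2 : planeToComplex.toHomeomorph '' E.drawingᶜ = (drawOn G E.cpos univ)ᶜ := by
    rw [image_compl_eq planeToComplex.toHomeomorph.bijective]
    exact congrArg _ E.image_drawing
  rw [h2] at h
  exact h

lemma PlaneEmb.mem_closure_face (E : PlaneEmb G) {q : ℝ × ℝ} (hq : q ∉ E.drawing) (v : V) :
    E.pos v ∈ closure (connectedComponentIn E.drawingᶜ q) ↔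
      E.cpos v ∈ closure (faceOn G E.cpos (planeToComplex q) univ) := by
  rw [← E.image_face hq]
  have := planeToComplex.toHomeomorph.image_closure (connectedComponentIn E.drawingᶜ q)
  change _ ↔ planeToComplex (E.pos v) ∈ closure (planeToComplex.toHomeomorph '' _)
  rw [← this]
  exact (planeToComplex.injective.mem_set_image).symm

lemma PlaneEmb.seg_subset_closure_face (E : PlaneEmb G) {q : ℝ × ℝ} (hq : q ∉ E.drawing)
    (u v : V) : seg (E.pos u) (E.pos v) ⊆ closure (connectedComponentIn E.drawingᶜ q) ↔
      segment ℝ (E.cpos u) (E.cpos v) ⊆ closure (faceOn G E.cpos (planeToComplex q) univ) := by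
  rw [← E.image_face hq]
  have := planeToComplex.toHomeomorph.image_closure (connectedComponentIn E.drawingᶜ q)
  change _ ↔ _ ⊆ closure (planeToComplex.toHomeomorph '' _)
  rw [← this]
  simp only [cpos]
  rw [← planeToComplex_image_seg]
  exact (image_subset_image_iff planeToComplex.injective).symm

/-- The embedding of a pulled back subgraph. -/
def PlaneEmb.restrict {W : Type} (E : PlaneEmb G) {H : SimpleGraph V} (hH : H ≤ G)
    (f : W ↪ V) : PlaneEmb (H.comap f) where
  pos w := E.pos (f w)
  inj := E.inj.comp f.injective
  edges_meet := by
    intro a b c d hab hcd hne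
    refine E.edges_meet (hH hab) (hH hcd) fun h => hne ?_
    exact Sym2.map.injective f.injective (by simpa using h)
  vertex_off := by
    intro a b v hab h1 h2
    exact E.vertex_off (hH hab) (f.injective.ne h1) (f.injective.ne h2)

lemma drawOn_comap {W : Type} (H : SimpleGraph V) (z : V → ℂ) (f : W ↪ V) :
    drawOn (H.comap f) (fun w => z (f w)) univ = drawOn H z (range f) := by
  ext p
  simp [drawOn]

lemma drawOn_mono_graph {H : SimpleGraph V} (hH : H ≤ G) (z : V → ℂ) (S : Set V) :
    drawOn H z S ⊆ drawOn G z univ := by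
  rintro p (⟨a, ha, rfl⟩ | ⟨a, ha, b, hb, hab, hp⟩)
  · exact Or.inl ⟨a, mem_univ a, rfl⟩
  · exact Or.inr ⟨a, mem_univ a, b, mem_univ b, hH hab, hp⟩

end Transfer

lemma hasCycleLen_of_comap {V W : Type} {G H : SimpleGraph V} (hH : H ≤ G) (f : W ↪ V) {n : ℕ}
    (h : HasCycleLen (H.comap f) n) : HasCycleLen G n := by
  obtain ⟨v, c, hc, hl⟩ := h
  let g : H.comap f →g G := ⟨f, fun hab => hH hab⟩
  exact ⟨_, c.map g, hc.map (f := g) f.injective, by simpa using hl⟩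

/-- Minimality: any admissible list assignment for a proper part of the configuration whose
precoloured path lies on the outer face has a colouring. -/
theorem Cfg4.MinCounterexample.exists_coloring {C : Cfg4} (hC : C.MinCounterexample)
    {q : ℝ × ℝ} (hq : q ∉ C.E.drawing) (hF : C.F = connectedComponentIn C.E.drawingᶜ q)
    {H : SimpleGraph (Fin C.n)} (hH : H ≤ C.G) {S : Set (Fin C.n)} (hS : S ≠ univ)
    {K : Set ℂ} (hK : K = closure (faceOn H C.E.cpos (planeToComplex q) S))
    {P : List (Fin C.n)} (hPS : ∀ v ∈ P, v ∈ S) (hnd : P.Nodup) (hlen : P.length ≤ 3)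
    (hPF : ∀ v ∈ P, C.E.cpos v ∈ K)
    (hch : P.IsChain fun u v => H.Adj u v ∧ segment ℝ (C.E.cpos u) (C.E.cpos v) ⊆ K)
    {L : Fin C.n → Finset ℕ} (hLint : ∀ u ∈ S, ∀ v ∈ S, H.Adj u v → (L u ∩ L v).card ≤ 1)
    (h3 : ∀ v ∈ S, v ∉ P → C.E.cpos v ∉ K → 3 ≤ (L v).card)
    (h2 : ∀ v ∈ S, v ∉ P → 2 ≤ (L v).card)
    (h1 : ∀ v ∈ P, (L v).card = 1)
    (h22 : ∀ u ∈ S, ∀ v ∈ S, H.Adj u v → (L u).card = 2 → (L v).card ≠ 2)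
    (hcol : ∃ φ : Fin C.n → ℕ, (∀ v ∈ P, φ v ∈ L v) ∧
      ∀ u ∈ P, ∀ v ∈ P, H.Adj u v → φ u ≠ φ v)
    (hvi : ∀ x ∈ S, (L x).card = 2 → ∀ u ∈ P, ∀ v ∈ P, u ≠ v → H.Adj x u → H.Adj x v → False) :
    ∃ φ : Fin C.n → ℕ, (∀ v ∈ S, φ v ∈ L v) ∧ ∀ u ∈ S, ∀ v ∈ S, H.Adj u v → φ u ≠ φ v := by
  classical
  set m := Fintype.card S with hm
  let e : Fin m ≃ S := (Fintype.equivFin S).symm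
  let f : Fin m ↪ Fin C.n := e.toEmbedding.trans (Function.Embedding.subtype _)
  have hfS : ∀ i, f i ∈ S := fun i => (e i).2
  have hrange : range f = S := by
    ext v
    constructor
    · rintro ⟨i, rfl⟩; exact hfS i
    · intro hv; exact ⟨e.symm ⟨v, hv⟩, by simp [f]⟩
  have hmn : m < C.n := by
    obtain ⟨v, hv⟩ := (ne_univ_iff_exists_notMem S).1 hS
    have := Fintype.card_subtype_lt (p := (· ∈ S)) hv
    simpa [hm] using this
  obtain ⟨P, rfl⟩ : ∃ P0 : List (Fin m), P0.map f = P := by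
    have : P ∈ range (List.map f) := by
      rw [range_list_map, hrange]; exact hPS
    exact this
  let E := C.E.restrict hH f
  have hcpos : E.cpos = fun i => C.E.cpos (f i) := rfl
  have hdraw : drawOn (H.comap f) E.cpos univ = drawOn H C.E.cpos S := by
    rw [hcpos, drawOn_comap, hrange]
  have hface : faceOn (H.comap f) E.cpos (planeToComplex q) univ =
      faceOn H C.E.cpos (planeToComplex q) S := by
    unfold faceOn; rw [hdraw]
  have hqE : q ∉ E.drawing := by
    intro h
    have h1 : planeToComplex q ∈ planeToComplex '' E.drawing := mem_image_of_mem _ h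
    rw [E.image_drawing, hdraw] at h1
    have h2 := drawOn_mono_graph hH _ _ h1
    rw [← C.E.image_drawing, planeToComplex.injective.mem_set_image] at h2
    exact hq h2
  have hon : ∀ i, E.pos i ∈ closure (connectedComponentIn E.drawingᶜ q) ↔ C.E.cpos (f i) ∈ K := by
    intro i
    rw [E.mem_closure_face hqE, hface, hK]
    exact Iff.rfl
  have hseg : ∀ i j, seg (E.pos i) (E.pos j) ⊆ closure (connectedComponentIn E.drawingᶜ q) ↔
      segment ℝ (C.E.cpos (f i)) (C.E.cpos (f j)) ⊆ K := by
    intro i j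
    rw [E.seg_subset_closure_face hqE, hface, hK]
    exact Iff.rfl
  let D : Cfg4 := ⟨m, H.comap f, E, connectedComponentIn E.drawingᶜ q, P, fun i => L (f i)⟩
  have hmem : ∀ i, f i ∈ P.map f ↔ i ∈ P := fun i => List.mem_map_of_injective f.injective
  have hsub : C.F ⊆ D.F := by
    rw [← image_subset_image_iff planeToComplex.injective, hF, C.E.image_face hq]
    change _ ⊆ planeToComplex '' connectedComponentIn E.drawingᶜ q
    rw [E.image_face hqE, hface]
    exact connectedComponentIn_mono _ (compl_subset_compl.2 (drawOn_mono_graph hH _ _))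
  obtain ⟨hV, -, hmin⟩ := hC
  obtain ⟨v4, vF, -⟩ := hV
  have hDV : D.Valid := by
    refine ⟨fun h => v4 (hasCycleLen_of_comap hH f h), ⟨⟨q, hqE, rfl⟩, fun h => vF.2 (h.subset hsub)⟩,
      hnd.of_map f, by simpa using hlen, ?_, ?_, ?_, ?_, ?_, ?_, ?_, ?_, ?_, ?_⟩
    · intro i hi
      exact (hon i).2 (hPF _ ((hmem i).2 hi))
    · refine ((List.isChain_map f).1 hch).imp fun i j hij => ⟨hij.1, (hseg i j).2 hij.2⟩
    · intro i
      by_cases hi : i ∈ P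
      · exact (h1 _ ((hmem i).2 hi)).ge
      · exact le_trans (by norm_num) (h2 _ (hfS i) (fun h => hi ((hmem i).1 h)))
    · intro i j hij
      exact hLint _ (hfS i) _ (hfS j) hij
    · intro i hi
      have hi' : C.E.cpos (f i) ∉ K := fun h => hi ((hon i).2 h)
      exact h3 _ (hfS i) (fun h => hi' (hPF _ h)) hi'
    · intro i _ hi
      exact h2 _ (hfS i) (fun h => hi ((hmem i).1 h))
    · intro i hi
      exact h1 _ ((hmem i).2 hi)
    · intro i j hij
      exact h22 _ (hfS i) _ (hfS j) hij
    · obtain ⟨φ, p1, p2⟩ := hcol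
      exact ⟨fun i => φ (f i), fun i hi => p1 _ ((hmem i).2 hi),
        fun i j hi hj hij => p2 _ ((hmem i).2 hi) _ ((hmem j).2 hj) hij⟩
    · intro i hi j hj k hk hjk
      exact hvi _ (hfS i) hi _ ((hmem j).2 hj) _ ((hmem k).2 hk) (f.injective.ne hjk)
  have hmeas : D.measure < C.measure := by
    have hle : Nat.card D.G.edgeSet ≤ Nat.card C.G.edgeSet := by
      let g : D.G →g C.G := ⟨f, fun hab => hH hab⟩
      exact Nat.card_le_card_of_injective (g.mapEdgeSet)
        (SimpleGraph.Hom.mapEdgeSet.injective g f.injective)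
    exact add_lt_add_of_lt_of_le hmn hle
  have hDc : D.Colorable := by
    by_contra h
    exact absurd (hmin D hDV h).1 (not_le.2 hmeas)
  obtain ⟨φ, p1, p2⟩ := hDc
  have hfe : ∀ v (hv : v ∈ S), f (e.symm ⟨v, hv⟩) = v := fun v hv => by simp [f]
  refine ⟨fun v => if hv : v ∈ S then φ (e.symm ⟨v, hv⟩) else 0, ?_, ?_⟩
  · intro v hv
    have := p1 (e.symm ⟨v, hv⟩)
    simp only [hv, dite_true]
    change _ ∈ L (f (e.symm ⟨v, hv⟩)) at this
    rwa [hfe v hv] at this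
  · intro u hu v hv huv
    simp only [hu, hv, dite_true]
    refine p2 ?_
    change H.Adj (f (e.symm ⟨u, hu⟩)) (f (e.symm ⟨v, hv⟩))
    rwa [hfe u hu, hfe v hv]

/-- A minimum counterexample, described in the complex plane. -/
structure IsMin {n : ℕ} (G : SimpleGraph (Fin n)) (z : Fin n → ℂ) (q : ℂ) (P : List (Fin n))
    (L : Fin n → Finset ℕ) : Prop where
  drawing : IsDrawing G z
  no_four : ∀ a b c d, G.Adj a b → G.Adj b c → G.Adj c d → G.Adj d a → a ≠ c → b ≠ d → False
  nodup : P.Nodup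
  length_le : P.length ≤ 3
  path_mem : ∀ v ∈ P, z v ∈ closure (faceOn G z q univ)
  chain : P.IsChain fun u v =>
    G.Adj u v ∧ segment ℝ (z u) (z v) ⊆ closure (faceOn G z q univ)
  inter : ∀ u v, G.Adj u v → (L u ∩ L v).card ≤ 1
  inner : ∀ v, z v ∉ closure (faceOn G z q univ) → 3 ≤ (L v).card
  outer : ∀ v, v ∉ P → 2 ≤ (L v).card
  path : ∀ v ∈ P, (L v).card = 1
  no_adj : ∀ u v, G.Adj u v → (L u).card = 2 → (L v).card ≠ 2
  path_col : ∃ φ : Fin n → ℕ, (∀ v ∈ P, φ v ∈ L v) ∧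
    ∀ u ∈ P, ∀ v ∈ P, G.Adj u v → φ u ≠ φ v
  no_two : ∀ x, (L x).card = 2 → ∀ u ∈ P, ∀ v ∈ P, u ≠ v → G.Adj x u → G.Adj x v → False
  not_col : ¬ ColorableWith G L
  minimal : ∀ (H : SimpleGraph (Fin n)) (_ : H ≤ G) (S : Set (Fin n)) (_ : S ≠ univ)
    (P : List (Fin n)) (_ : ∀ v ∈ P, v ∈ S) (_ : P.Nodup) (_ : P.length ≤ 3)
    (_ : ∀ v ∈ P, z v ∈ closure (faceOn H z q S))
    (_ : P.IsChain fun u v => H.Adj u v ∧ segment ℝ (z u) (z v) ⊆ closure (faceOn H z q S))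
    (L : Fin n → Finset ℕ) (_ : ∀ u ∈ S, ∀ v ∈ S, H.Adj u v → (L u ∩ L v).card ≤ 1)
    (_ : ∀ v ∈ S, v ∉ P → z v ∉ closure (faceOn H z q S) → 3 ≤ (L v).card)
    (_ : ∀ v ∈ S, v ∉ P → 2 ≤ (L v).card)
    (_ : ∀ v ∈ P, (L v).card = 1)
    (_ : ∀ u ∈ S, ∀ v ∈ S, H.Adj u v → (L u).card = 2 → (L v).card ≠ 2)
    (_ : ∃ φ : Fin n → ℕ, (∀ v ∈ P, φ v ∈ L v) ∧
      ∀ u ∈ P, ∀ v ∈ P, H.Adj u v → φ u ≠ φ v)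
    (_ : ∀ x ∈ S, (L x).card = 2 → ∀ u ∈ P, ∀ v ∈ P, u ≠ v → H.Adj x u → H.Adj x v → False),
    ∃ φ : Fin n → ℕ, (∀ v ∈ S, φ v ∈ L v) ∧ ∀ u ∈ S, ∀ v ∈ S, H.Adj u v → φ u ≠ φ v

lemma hasCycleLen_four {V : Type} {G : SimpleGraph V} {a b c d : V} (hab : G.Adj a b)
    (hbc : G.Adj b c) (hcd : G.Adj c d) (hda : G.Adj d a) (hac : a ≠ c) (hbd : b ≠ d) :
    HasCycleLen G 4 := by
  refine ⟨a, .cons hab (.cons hbc (.cons hcd (.cons hda .nil))), ?_, rfl⟩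
  have h1 := hab.ne
  have h2 := hbc.ne
  have h3 := hcd.ne
  have h4 := hda.ne
  rw [SimpleGraph.Walk.cons_isCycle_iff]
  constructor
  · simp [SimpleGraph.Walk.cons_isPath_iff, h2, h3, h4, hac.symm, hbd, h1.symm]
  · simp [h1, h2, hac, hbd, h1.symm, h4.symm]

lemma Cfg4.MinCounterexample.isMin {C : Cfg4} (hC : C.MinCounterexample)
    {q : ℝ × ℝ} (hq : q ∉ C.E.drawing) (hF : C.F = connectedComponentIn C.E.drawingᶜ q) :
    IsMin C.G C.E.cpos (planeToComplex q) C.P C.L := by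
  obtain ⟨⟨v4, vF, v1, v2, v3, vch, -, vint, vin, vout, vP, v22, vcol, vvi⟩, hnc, -⟩ := id hC
  have hon : ∀ v, v ∈ C.E.onFace C.F ↔
      C.E.cpos v ∈ closure (faceOn C.G C.E.cpos (planeToComplex q) univ) := by
    intro v
    rw [← C.E.mem_closure_face hq, ← hF]
    exact Iff.rfl
  refine ⟨C.E.isDrawing, fun a b c d h1 h2 h3 h4 h5 h6 => v4 (hasCycleLen_four h1 h2 h3 h4 h5 h6),
    v1, v2, fun v hv => (hon v).1 (v3 v hv), vch.imp fun u v h => ⟨h.1, ?_⟩, vint,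
    fun v hv => vin v fun h => hv ((hon v).1 h), ?_, vP, v22, ?_, vvi, hnc, ?_⟩
  · rw [← C.E.seg_subset_closure_face hq, ← hF]
    exact h.2
  · intro v hv
    by_cases h : v ∈ C.E.onFace C.F
    · exact vout v h hv
    · exact le_trans (by norm_num) (vin v h)
  · obtain ⟨φ, h1, h2⟩ := vcol
    exact ⟨φ, h1, fun u hu v hv => h2 hu hv⟩
  · intro H hH S hS P hPS hnd hlen hPF hch L hLint h3 h2 h1 h22 hcol hvi
    exact hC.exists_coloring hq hF hH hS rfl hPS hnd hlen hPF hch hLint h3 h2 h1 h22 hcol hvi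

lemma closure_faceOn_anti {V : Type} {G : SimpleGraph V} {z : V → ℂ} {q : ℂ} (S : Set V) :
    closure (faceOn G z q univ) ⊆ closure (faceOn G z q S) :=
  closure_mono (faceOn_anti (subset_univ S))

section Glue

variable {n : ℕ} {G : SimpleGraph (Fin n)} {z : Fin n → ℂ} {q : ℂ} {P : List (Fin n)}
  {L : Fin n → Finset ℕ}

/-- Deleting a nonempty set of vertices leaves a graph in which a suitable precolouring of a
path on the outer face extends. -/
theorem IsMin.exists_extension (h : IsMin G z q P L) {A : Set (Fin n)} (hA : A.Nonempty)
    {P' : List (Fin n)} (hP'A : ∀ v ∈ P', v ∉ A) (hnd : P'.Nodup) (hlen : P'.length ≤ 3)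
    (hPF : ∀ v ∈ P', z v ∈ closure (faceOn G z q Aᶜ))
    (hch : P'.IsChain fun u v =>
      G.Adj u v ∧ segment ℝ (z u) (z v) ⊆ closure (faceOn G z q Aᶜ))
    (hPP' : ∀ v ∈ P, v ∉ A → v ∈ P') {ψ : Fin n → ℕ} (hψ : ∀ v ∈ P', ψ v ∈ L v)
    (hψ' : ∀ u ∈ P', ∀ v ∈ P', G.Adj u v → ψ u ≠ ψ v)
    (hvi : ∀ x, x ∉ A → x ∉ P' → (L x).card = 2 → ∀ u ∈ P', ∀ v ∈ P', u ≠ v → G.Adj x u →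
      G.Adj x v → False) :
    ∃ φ : Fin n → ℕ, (∀ v, v ∉ A → φ v ∈ L v) ∧ (∀ v ∈ P', φ v = ψ v) ∧
      ∀ u v, u ∉ A → v ∉ A → G.Adj u v → φ u ≠ φ v := by
  classical
  set L' : Fin n → Finset ℕ := fun v => if v ∈ P' then {ψ v} else L v with hL'
  have hL1 : ∀ v ∈ P', L' v = {ψ v} := fun v hv => by simp [hL', hv]
  have hL2 : ∀ v, v ∉ P' → L' v = L v := fun v hv => by simp [hL', hv]
  have hsub : ∀ v, L' v ⊆ L v := by
    intro v
    by_cases hv : v ∈ P'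
    · rw [hL1 v hv, Finset.singleton_subset_iff]; exact hψ v hv
    · rw [hL2 v hv]
  have hnot : ∀ v, (L' v).card = 2 → v ∉ P' := by
    intro v hv hvP
    rw [hL1 v hvP, Finset.card_singleton] at hv
    norm_num at hv
  obtain ⟨φ, h1, h2⟩ := h.minimal G le_rfl Aᶜ
    (by rw [Ne, compl_univ_iff]; exact hA.ne_empty) P' hP'A hnd hlen hPF hch L'
    (fun u _ v _ huv => (Finset.card_le_card (Finset.inter_subset_inter (hsub u) (hsub v))).trans
      (h.inter u v huv))
    (fun v _ hv hz => by
      rw [hL2 v hv]; exact h.inner v fun h' => hz (closure_faceOn_anti _ h'))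
    (fun v hvA hv => by
      rw [hL2 v hv]; exact h.outer v fun h' => hv (hPP' v h' hvA))
    (fun v hv => by rw [hL1 v hv, Finset.card_singleton])
    (fun u _ v _ huv hu hv => by
      rw [hL2 u (hnot u hu)] at hu
      rw [hL2 v (hnot v hv)] at hv
      exact h.no_adj u v huv hu hv)
    ⟨ψ, fun v hv => by rw [hL1 v hv]; exact Finset.mem_singleton_self _, hψ'⟩
    (fun x hxA hx => hvi x hxA (hnot x hx) (by rwa [hL2 x (hnot x hx)] at hx))
  refine ⟨φ, fun v hv => hsub v (h1 v hv), fun v hv => ?_, fun u v hu hv => h2 u hu v hv⟩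
  by_cases hvA : v ∈ A
  · exact absurd hvA (hP'A v hv)
  · have := h1 v hvA
    rw [hL1 v hv] at this
    exact Finset.mem_singleton.1 this

/-- A minimum counterexample cannot be split along a path whose colours can be prescribed. -/
theorem IsMin.glue (h : IsMin G z q P L) {A B : Set (Fin n)} (hA : A.Nonempty) (hB : B.Nonempty)
    (hAB : Disjoint A B) (hno : ∀ a ∈ A, ∀ b ∈ B, ¬ G.Adj a b) {P1 P2 : List (Fin n)}
    (hcov : ∀ y, y ∉ A → y ∉ B → y ∈ P2)
    (hP1 : ∀ v ∈ P1, v ∈ P ∧ v ∉ A) (hPP1 : ∀ v ∈ P, v ∉ A → v ∈ P1) (hnd1 : P1.Nodup)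
    (hlen1 : P1.length ≤ 3)
    (hch1 : P1.IsChain fun u v =>
      G.Adj u v ∧ segment ℝ (z u) (z v) ⊆ closure (faceOn G z q Aᶜ))
    (hP2B : ∀ v ∈ P2, v ∉ B) (hP2A : ∀ v ∈ P2, v ∈ A → v ∈ P) (hPP2 : ∀ v ∈ P, v ∉ B → v ∈ P2)
    (hnd2 : P2.Nodup) (hlen2 : P2.length ≤ 3)
    (hPF2 : ∀ v ∈ P2, z v ∈ closure (faceOn G z q Bᶜ))
    (hch2 : P2.IsChain fun u v =>
      G.Adj u v ∧ segment ℝ (z u) (z v) ⊆ closure (faceOn G z q Bᶜ))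
    (hx : ∀ u ∈ P2, u ∈ A → ∀ v ∈ P2, v ∉ A → G.Adj u v → v ∈ P)
    (hvi : ∀ x ∈ A, x ∉ P → (L x).card = 2 → ∀ u ∈ P2, ∀ v ∈ P2, u ≠ v → G.Adj x u →
      G.Adj x v → False) : False := by
  classical
  obtain ⟨ψ, p1, p2⟩ := h.path_col
  obtain ⟨φ, f1, f2, f3⟩ := h.exists_extension hA (P' := P1) (fun v hv => (hP1 v hv).2) hnd1 hlen1
    (fun v hv => closure_faceOn_anti _ (h.path_mem v (hP1 v hv).1)) hch1 hPP1
    (fun v hv => p1 v (hP1 v hv).1)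
    (fun u hu v hv => p2 u (hP1 u hu).1 v (hP1 v hv).1)
    (fun x _ _ hx u hu v hv => h.no_two x hx u (hP1 u hu).1 v (hP1 v hv).1)
  set ψ2 : Fin n → ℕ := fun v => if v ∈ A then ψ v else φ v with hψ2
  have s1 : ∀ v ∈ A, ψ2 v = ψ v := fun v hv => by simp [hψ2, hv]
  have s2 : ∀ v, v ∉ A → ψ2 v = φ v := fun v hv => by simp [hψ2, hv]
  have hcross : ∀ u ∈ P2, u ∈ A → ∀ v ∈ P2, v ∉ A → G.Adj u v → ψ2 u ≠ ψ2 v := by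
    intro u hu huA v hv hvA huv
    have hvP := hx u hu huA v hv hvA huv
    rw [s1 u huA, s2 v hvA, f2 v (hPP1 v hvP hvA)]
    exact p2 u (hP2A u hu huA) v hvP huv
  obtain ⟨χ, g1, g2, g3⟩ := h.exists_extension hB (P' := P2) hP2B hnd2 hlen2 hPF2 hch2 hPP2
    (ψ := ψ2)
    (fun v hv => by
      by_cases hvA : v ∈ A
      · rw [s1 v hvA]; exact p1 v (hP2A v hv hvA)
      · rw [s2 v hvA]; exact f1 v hvA)
    (fun u hu v hv huv => by
      by_cases huA : u ∈ A <;> by_cases hvA : v ∈ A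
      · rw [s1 u huA, s1 v hvA]; exact p2 u (hP2A u hu huA) v (hP2A v hv hvA) huv
      · exact hcross u hu huA v hv hvA huv
      · exact (hcross v hv hvA u hu huA huv.symm).symm
      · rw [s2 u huA, s2 v hvA]; exact f3 u v huA hvA huv)
    (fun x hxB hxP2 hx => by
      have hxA : x ∈ A := by
        by_contra hxA; exact hxP2 (hcov x hxA hxB)
      exact hvi x hxA (fun hxP => hxP2 (hPP2 x hxP hxB)) hx)
  have hmix : ∀ u v, u ∈ A → v ∉ A → G.Adj u v → χ u ≠ φ v := by
    intro u v hu hv huv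
    have hvB : v ∉ B := fun hvB => hno u hu v hvB huv
    have := g2 v (hcov v hv hvB)
    rw [s2 v hv] at this
    rw [← this]
    exact g3 u v (disjoint_left.1 hAB hu) hvB huv
  refine h.not_col ⟨fun v => if v ∈ A then χ v else φ v, fun v => ?_, fun u v huv => ?_⟩
  · by_cases hv : v ∈ A
    · simp only [hv, if_true]; exact g1 v (disjoint_left.1 hAB hv)
    · simp only [hv, if_false]; exact f1 v hv
  · by_cases hu : u ∈ A <;> by_cases hv : v ∈ A <;> simp only [hu, hv, if_true, if_false]
    · exact g3 u v (disjoint_left.1 hAB hu) (disjoint_left.1 hAB hv) huv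
    · exact hmix u v hu hv huv
    · exact (hmix v u hv hu huv.symm).symm
    · exact f3 u v hu hv huv

/-- The case of `IsMin.glue` where the whole precoloured path is on one side. -/
theorem IsMin.glue_one (h : IsMin G z q P L) {A B : Set (Fin n)} (hA : A.Nonempty)
    (hB : B.Nonempty) (hAB : Disjoint A B) (hno : ∀ a ∈ A, ∀ b ∈ B, ¬ G.Adj a b)
    (hPA : ∀ v ∈ P, v ∉ A) {Q : List (Fin n)} (hQ : ∀ y, y ∈ Q ↔ y ∉ A ∧ y ∉ B)
    (hnd : Q.Nodup) (hlen : Q.length ≤ 3) (hQF : ∀ v ∈ Q, z v ∈ closure (faceOn G z q Bᶜ))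
    (hch : Q.IsChain fun u v =>
      G.Adj u v ∧ segment ℝ (z u) (z v) ⊆ closure (faceOn G z q Bᶜ))
    (hvi : ∀ x, x ∉ P → (L x).card = 2 → ∀ u ∈ Q, ∀ v ∈ Q, u ≠ v → G.Adj x u →
      G.Adj x v → False) : False := by
  refine h.glue hA hB hAB hno (P1 := P) (P2 := Q) (fun y h1 h2 => (hQ y).2 ⟨h1, h2⟩)
    (fun v hv => ⟨hv, hPA v hv⟩) (fun v hv _ => hv) h.nodup h.length_le
    (h.chain.imp fun u v huv => ⟨huv.1, huv.2.trans (closure_faceOn_anti _)⟩)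
    (fun v hv => ((hQ v).1 hv).2) (fun v hv hvA => absurd hvA ((hQ v).1 hv).1)
    (fun v hv hvB => (hQ v).2 ⟨hPA v hv, hvB⟩) hnd hlen hQF hch
    (fun u hu huA => absurd huA ((hQ u).1 hu).1) (fun x _ => hvi x)

lemma chain_one_side {V : Type} {G : SimpleGraph V} {A B : Set V} {R : V → V → Prop}
    (hR : ∀ u v, R u v → G.Adj u v) (hAB : Disjoint A B)
    (hno : ∀ a ∈ A, ∀ b ∈ B, ¬ G.Adj a b) :
    ∀ l : List V, l.IsChain R → (∀ v ∈ l, v ∈ A ∨ v ∈ B) →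
      (∀ v ∈ l, v ∉ A) ∨ (∀ v ∈ l, v ∉ B)
  | [], _, _ => Or.inl (by simp)
  | [a], _, h => by
    rcases h a (by simp) with h | h
    · exact Or.inr (by simpa using disjoint_left.1 hAB h)
    · exact Or.inl (by simpa using disjoint_right.1 hAB h)
  | a :: b :: l, hl, h => by
    rw [List.isChain_cons_cons] at hl
    have hab := hR a b hl.1
    rcases chain_one_side hR hAB hno (b :: l) hl.2 (fun v hv => h v (List.mem_cons_of_mem a hv))
      with ih | ih
    · refine Or.inl fun v hv => ?_
      rcases List.mem_cons.1 hv with rfl | hv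
      · have hb := (h b (by simp)).resolve_left (ih b (by simp))
        exact fun ha => hno v ha b hb hab
      · exact ih v hv
    · refine Or.inr fun v hv => ?_
      rcases List.mem_cons.1 hv with rfl | hv
      · have hb := (h b (by simp)).resolve_right (ih b (by simp))
        exact fun ha => hno b hb v ha hab.symm
      · exact ih v hv

end Glue

lemma chain_sides {V : Type} {G : SimpleGraph V} {A B : Set V} {R : V → V → Prop}
    (hR : ∀ u v, R u v → G.Adj u v) (hAB : Disjoint A B)
    (hno : ∀ a ∈ A, ∀ b ∈ B, ¬ G.Adj a b) {x : V}
    {l : List V} (hl : l.IsChain R) (hnd : l.Nodup) (hlen : l.length ≤ 3)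
    (hcov : ∀ v ∈ l, v ≠ x → v ∈ A ∨ v ∈ B) :
    ((∀ v ∈ l, v ∉ A) ∨ (∀ v ∈ l, v ∉ B)) ∨
      ∃ a b, l = [a, x, b] ∧ ((a ∈ A ∧ b ∈ B) ∨ (a ∈ B ∧ b ∈ A)) := by
  have hd : ∀ v ∈ A, v ∉ B := fun v hv => disjoint_left.1 hAB hv
  match l, hl, hnd, hlen, hcov with
  | [], _, _, _, _ => simp
  | [a], _, _, _, _ => simp; grind
  | [a, b], hl, _, _, hcov =>
    simp only [List.isChain_cons_cons, List.isChain_singleton, and_true] at hl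
    have h1 := hR _ _ hl
    have h2 := h1.symm
    simp at hcov ⊢
    grind
  | [a, b, c], hl, hnd, _, hcov =>
    simp only [List.isChain_cons_cons, List.isChain_singleton, and_true] at hl
    have h1 := hR _ _ hl.1
    have h2 := h1.symm
    have h3 := hR _ _ hl.2
    have h4 := h3.symm
    simp at hcov hnd ⊢
    grind
  | _ :: _ :: _ :: _ :: _, _, _, hlen, _ => simp at hlen; omega

section Reduce

variable {n : ℕ} {G : SimpleGraph (Fin n)} {z : Fin n → ℂ} {q : ℂ} {P : List (Fin n)}
  {L : Fin n → Finset ℕ}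

lemma IsMin.glue_sides (h : IsMin G z q P L) {A B : Set (Fin n)} (hA : A.Nonempty)
    (hB : B.Nonempty) (hAB : Disjoint A B) (hno : ∀ a ∈ A, ∀ b ∈ B, ¬ G.Adj a b)
    (hP : (∀ v ∈ P, v ∉ A) ∨ (∀ v ∈ P, v ∉ B)) {Q : List (Fin n)}
    (hQ : ∀ y, y ∈ Q ↔ y ∉ A ∧ y ∉ B) (hnd : Q.Nodup) (hlen : Q.length ≤ 3)
    (hQF : ∀ v ∈ Q, z v ∈ closure (faceOn G z q Aᶜ) ∧ z v ∈ closure (faceOn G z q Bᶜ))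
    (hch : Q.IsChain fun u v =>
      G.Adj u v ∧ segment ℝ (z u) (z v) ⊆ closure (faceOn G z q Aᶜ) ∧
        segment ℝ (z u) (z v) ⊆ closure (faceOn G z q Bᶜ))
    (hvi : ∀ x, x ∉ P → (L x).card = 2 → ∀ u ∈ Q, ∀ v ∈ Q, u ≠ v → G.Adj x u →
      G.Adj x v → False) : False := by
  rcases hP with hP | hP
  · exact h.glue_one hA hB hAB hno hP hQ hnd hlen (fun v hv => (hQF v hv).2)
      (hch.imp fun u v huv => ⟨huv.1, huv.2.2⟩) hvi
  · exact h.glue_one hB hA hAB.symm (fun b hb a ha hab => hno a ha b hb hab.symm) hP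
      (fun y => (hQ y).trans and_comm) hnd hlen (fun v hv => (hQF v hv).1)
      (hch.imp fun u v huv => ⟨huv.1, huv.2.1⟩) hvi

lemma IsMin.notMem_path (h : IsMin G z q P L) {v : Fin n} (hv : (L v).card = 2) : v ∉ P :=
  fun hP => by have := h.path v hP; omega

lemma IsMin.mem_face (h : IsMin G z q P L) {v : Fin n} (hv : (L v).card = 2) :
    z v ∈ closure (faceOn G z q univ) := by
  by_contra hF
  have := h.inner v hF
  omega

lemma IsMin.chain_adj (_ : IsMin G z q P L) {S : Set (Fin n)} (u v : Fin n)
    (huv : G.Adj u v ∧ segment ℝ (z u) (z v) ⊆ closure (faceOn G z q S)) : G.Adj u v := huv.1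

/-- A vertex with two colours is not a cut vertex. -/
lemma IsMin.no_cut_vertex (h : IsMin G z q P L) {v : Fin n} (hv : (L v).card = 2)
    {A B : Set (Fin n)} (hAB : Disjoint A B) (hQ : ∀ y, y = v ↔ y ∉ A ∧ y ∉ B)
    (hno : ∀ a ∈ A, ∀ b ∈ B, ¬ G.Adj a b) (hA : A.Nonempty) (hB : B.Nonempty) : False := by
  refine h.glue_sides hA hB hAB hno ?_ (Q := [v]) (fun y => by simpa using hQ y) (by simp)
    (by simp) ?_ (by simp) (by simp +contextual)
  · refine chain_one_side h.chain_adj hAB hno P h.chain fun w hw => ?_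
    by_contra hc
    rw [not_or] at hc
    exact h.notMem_path hv ((hQ w).2 hc ▸ hw)
  · intro w hw
    rw [List.mem_singleton.1 hw]
    exact ⟨closure_faceOn_anti _ (h.mem_face hv), closure_faceOn_anti _ (h.mem_face hv)⟩

lemma IsMin.no_crossing (a b x : Fin n) (h : IsMin G z q [a, x, b] L) {v : Fin n}
    (hv : (L v).card = 2) (hvx : G.Adj v x) {A B : Set (Fin n)} (hAB : Disjoint A B)
    (hQ : ∀ y, y = v ∨ y = x ↔ y ∉ A ∧ y ∉ B) (hno : ∀ a ∈ A, ∀ b ∈ B, ¬ G.Adj a b)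
    (hs : segment ℝ (z v) (z x) ⊆ closure (faceOn G z q Bᶜ)) (ha : a ∈ A) (hb : b ∈ B) :
    False := by
  have hvP := h.notMem_path hv
  have hvo := (hQ v).1 (Or.inl rfl)
  have hxo := (hQ x).1 (Or.inr rfl)
  have haB := disjoint_left.1 hAB ha
  have hbA := disjoint_right.1 hAB hb
  have hch := h.chain
  have hnd := h.nodup
  simp only [List.isChain_cons_cons, List.isChain_singleton, and_true] at hch
  simp only [List.mem_cons, List.not_mem_nil, or_false, not_or] at hvP
  simp only [List.nodup_cons, List.mem_cons, List.not_mem_nil, or_false, not_or] at hnd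
  have hva : ¬ G.Adj v a := fun hva =>
    h.no_two v hv a (by simp) x (by simp) hnd.1.1 hva hvx
  have hF : ∀ w ∈ [v, x, a], z w ∈ closure (faceOn G z q univ) := by
    intro w hw
    simp only [List.mem_cons, List.not_mem_nil, or_false] at hw
    rcases hw with rfl | rfl | rfl
    · exact h.mem_face hv
    · exact h.path_mem w (by simp)
    · exact h.path_mem w (by simp)
  refine h.glue ⟨a, ha⟩ ⟨b, hb⟩ hAB hno (P1 := [x, b]) (P2 := [v, x, a]) ?_ ?_ ?_ ?_ ?_ ?_ ?_ ?_ ?_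
    ?_ ?_ (fun w hw => closure_faceOn_anti _ (hF w hw)) ?_ ?_ ?_
  · intro y h1 h2
    have := (hQ y).2 ⟨h1, h2⟩
    simp only [List.mem_cons]
    tauto
  · intro w hw
    rcases List.mem_pair.1 hw with rfl | rfl
    · exact ⟨by simp, hxo.1⟩
    · exact ⟨by simp, hbA⟩
  · intro w hw hwA
    simp only [List.mem_cons, List.not_mem_nil, or_false] at hw ⊢
    rcases hw with rfl | hw
    · exact absurd ha hwA
    · exact hw
  · simpa using hnd.2.1
  · simp
  · simpa using ⟨hch.2.1, hch.2.2.trans (closure_faceOn_anti _)⟩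
  · intro w hw
    simp only [List.mem_cons, List.not_mem_nil, or_false] at hw
    rcases hw with rfl | rfl | rfl
    exacts [hvo.2, hxo.2, haB]
  · intro w hw hwA
    simp only [List.mem_cons, List.not_mem_nil, or_false] at hw
    rcases hw with rfl | rfl | rfl
    · exact absurd hwA hvo.1
    · simp
    · simp
  · intro w hw hwB
    simp only [List.mem_cons, List.not_mem_nil, or_false] at hw ⊢
    rcases hw with rfl | rfl | rfl
    · simp
    · simp
    · exact absurd hb hwB
  · simp only [List.nodup_cons, List.mem_cons, List.not_mem_nil, or_false, not_or]
    exact ⟨⟨hvP.2.1, hvP.1⟩, fun h => hnd.1.1 h.symm, by simp⟩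
  · simp
  · simp only [List.isChain_cons_cons, List.isChain_singleton, and_true]
    refine ⟨⟨hvx, hs⟩, hch.1.1.symm, ?_⟩
    rw [segment_symm]
    exact hch.1.2.trans (closure_faceOn_anti _)
  · intro u hu huA w hw hwA huw
    simp only [List.mem_cons, List.not_mem_nil, or_false] at hu hw
    rcases hu with rfl | rfl | rfl
    · exact absurd huA hvo.1
    · exact absurd huA hxo.1
    · rcases hw with rfl | rfl | rfl
      · exact absurd huw.symm hva
      · simp
      · simp
  · intro y _ _ hy u hu w hw huw hyu hyw
    have hyv : ¬ G.Adj y v := fun hyv => h.no_adj y v hyv hy hv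
    have key : ∀ t ∈ [v, x, a], G.Adj y t → t ∈ [a, x, b] := by
      intro t ht hyt
      simp only [List.mem_cons, List.not_mem_nil, or_false] at ht
      rcases ht with rfl | rfl | rfl
      · exact absurd hyt hyv
      · simp
      · simp
    exact h.no_two y hy u (key u hu hyu) w (key w hw hyw) huw hyu hyw

/-- The two-colour vertices are not incident with chords. -/
lemma IsMin.no_chord (h : IsMin G z q P L) {v a b x : Fin n} (hv : (L v).card = 2)
    (hva : G.Adj v a) (hvb : G.Adj v b) (hab : a ≠ b)
    (ha : segment ℝ (z v) (z a) ⊆ closure (faceOn G z q univ))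
    (hb : segment ℝ (z v) (z b) ⊆ closure (faceOn G z q univ))
    (hvx : G.Adj v x) (hxa : x ≠ a) (hxb : x ≠ b) : z x ∉ closure (faceOn G z q univ) := by
  intro hx
  by_cases hs : segment ℝ (z v) (z x) ⊆ closure (faceOn G z q univ)
  · obtain ⟨A, B, hAB, hQ, hno, hA, hB⟩ := three_edges h.drawing hva hvb hvx hab hxb.symm
      hxa.symm ha hb hs
    exact h.no_cut_vertex hv hAB hQ hno hA hB
  have hvF := h.mem_face hv
  obtain ⟨A, B, hAB, hQ, hno, sA, sB⟩ := split_edge h.drawing hvx hvF hx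
  have hA : A.Nonempty := by
    rw [nonempty_iff_ne_empty]
    rintro rfl
    rw [compl_empty] at sA
    exact hs sA
  have hB : B.Nonempty := by
    rw [nonempty_iff_ne_empty]
    rintro rfl
    rw [compl_empty] at sB
    exact hs sB
  have hvP := h.notMem_path hv
  have hvo := (hQ v).1 (Or.inl rfl)
  have hxo := (hQ x).1 (Or.inr rfl)
  have hcov : ∀ w ∈ P, w ≠ x → w ∈ A ∨ w ∈ B := by
    intro w hw hwx
    by_contra hc
    rw [not_or] at hc
    rcases (hQ w).2 hc with rfl | rfl
    · exact hvP hw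
    · exact hwx rfl
  rcases chain_sides h.chain_adj hAB hno h.chain h.nodup h.length_le hcov with
    hP | ⟨a', b', rfl, hP⟩
  · refine h.glue_sides hA hB hAB hno hP (Q := [v, x]) (fun y => by simpa using hQ y)
      (by simp [hvx.ne]) (by simp) ?_ (by simpa using ⟨hvx, sA, sB⟩) ?_
    · intro w hw
      have : z w ∈ closure (faceOn G z q univ) := by
        rcases List.mem_pair.1 hw with rfl | rfl
        · exact hvF
        · exact hx
      exact ⟨closure_faceOn_anti _ this, closure_faceOn_anti _ this⟩
    · intro y _ hy u hu w hw huw hyu hyw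
      have : G.Adj y v := by
        rcases List.mem_pair.1 hu with rfl | rfl
        · exact hyu
        · rcases List.mem_pair.1 hw with rfl | rfl
          · exact hyw
          · exact absurd rfl huw
      exact h.no_adj y v this hy hv
  · rcases hP with ⟨ha', hb'⟩ | ⟨ha', hb'⟩
    · exact IsMin.no_crossing a' b' x h hv hvx hAB hQ hno sB ha' hb'
    · exact IsMin.no_crossing a' b' x h hv hvx hAB.symm (fun y => (hQ y).trans and_comm)
        (fun b hb a ha hab => hno a ha b hb hab.symm) sA ha' hb'

/-- A two-colour vertex `v` and a vertex `u` of the outer face that is not an inner vertex of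
`P` cannot be joined through an inner vertex `x`, unless `x` and `u` have a common two-colour
neighbour. -/
lemma IsMin.no_two_chord (h : IsMin G z q P L) {v x u : Fin n} (hv : (L v).card = 2)
    (hvx : G.Adj v x) (hxu : G.Adj x u) (hvu : v ≠ u) (hnvu : ¬ G.Adj v u)
    (hx : z x ∉ closure (faceOn G z q univ)) (hu : z u ∈ closure (faceOn G z q univ))
    (hP : u ∈ P → (∃ l, P = u :: l) ∨ ∃ l, P = l ++ [u])
    (hvi : ∀ y, y ∉ P → (L y).card = 2 → G.Adj y x → G.Adj y u → False) : False := by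
  have hvF := h.mem_face hv
  obtain ⟨A, B, hAB, hQ, hno, sA1, sA2, sB1, sB2⟩ := split_path h.drawing hvx hxu hvu hnvu hvF hu
  have hA : A.Nonempty := by
    rw [nonempty_iff_ne_empty]
    rintro rfl
    rw [compl_empty] at sA1
    exact hx (sA1 (right_mem_segment _ _ _))
  have hB : B.Nonempty := by
    rw [nonempty_iff_ne_empty]
    rintro rfl
    rw [compl_empty] at sB1
    exact hx (sB1 (right_mem_segment _ _ _))
  have hcov : ∀ w ∈ P, w ≠ u → w ∈ A ∨ w ∈ B := by
    intro w hw hwu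
    by_contra hc
    rw [not_or] at hc
    rcases (hQ w).2 hc with rfl | rfl | rfl
    · exact h.notMem_path hv hw
    · exact hx (h.path_mem w hw)
    · exact hwu rfl
  have hside : (∀ v ∈ P, v ∉ A) ∨ (∀ v ∈ P, v ∉ B) := by
    rcases chain_sides h.chain_adj hAB hno h.chain h.nodup h.length_le hcov with
      hs | ⟨a, b, hab, -⟩
    · exact hs
    · have hnd := h.nodup
      subst hab
      exfalso
      rcases hP (by simp) with ⟨l, hl⟩ | ⟨l, hl⟩
      · simp at hl hnd
        exact hnd.1.1 hl.1
      · have := congrArg List.getLast? hl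
        simp at this hnd
        exact hnd.2 this.symm
  refine h.glue_sides hA hB hAB hno hside (Q := [v, x, u]) (fun y => by simpa using hQ y) ?_
    (by simp) ?_ ?_ ?_
  · simp [hvx.ne, hxu.ne, hvu]
  · intro w hw
    simp only [List.mem_cons, List.not_mem_nil, or_false] at hw
    rcases hw with rfl | rfl | rfl
    · exact ⟨sA1 (left_mem_segment _ _ _), sB1 (left_mem_segment _ _ _)⟩
    · exact ⟨sA1 (right_mem_segment _ _ _), sB1 (right_mem_segment _ _ _)⟩
    · exact ⟨sA2 (right_mem_segment _ _ _), sB2 (right_mem_segment _ _ _)⟩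
  · simp only [List.isChain_cons_cons, List.isChain_singleton, and_true]
    exact ⟨⟨hvx, sA1, sB1⟩, hxu, sA2, sB2⟩
  · intro y hyP hy s hs t ht hst hys hyt
    have hyv : ¬ G.Adj y v := fun hyv => h.no_adj y v hyv hy hv
    simp only [List.mem_cons, List.not_mem_nil, or_false] at hs ht
    have := hvi y hyP hy
    rcases hs with rfl | rfl | rfl <;> rcases ht with rfl | rfl | rfl <;> tauto

lemma IsMin.no_two_chord_two (h : IsMin G z q P L) {v x u : Fin n} (hv : (L v).card = 2)
    (hu : (L u).card = 2) (hvx : G.Adj v x) (hxu : G.Adj x u) (hvu : v ≠ u)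
    (hx : z x ∉ closure (faceOn G z q univ)) : False := by
  refine h.no_two_chord hv hvx hxu hvu (fun hvu => h.no_adj v u hvu hv hu) hx (h.mem_face hu)
    (fun huP => absurd huP (h.notMem_path hu)) fun y _ hy _ hyu => h.no_adj y u hyu hy hu

lemma IsMin.no_two_chord_path_aux (h : IsMin G z q P L) {v x p p' : Fin n}
    (hv : (L v).card = 2) (hvx : G.Adj v x) (hx : z x ∉ closure (faceOn G z q univ))
    (hp : p ∈ P) (hp' : p' ∈ P) (hpp : G.Adj p p') (hxp : G.Adj x p) (hxp' : G.Adj x p')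
    (hP : (∃ l, P = p :: l) ∨ ∃ l, P = l ++ [p]) : False := by
  have hne : ∀ y, (L y).card = 2 → ∀ w ∈ P, y ≠ w := by
    rintro y hy w hw rfl
    exact h.notMem_path hy hw
  have key : ∀ y, (L y).card = 2 → G.Adj y x → ¬ G.Adj y p := fun y hy hyx hyp =>
    h.no_four y p p' x hyp hpp hxp'.symm hyx.symm (hne y hy p' hp') hxp.ne'
  exact h.no_two_chord hv hvx hxp (hne v hv p hp) (key v hv hvx) hx (h.path_mem p hp)
    (fun _ => hP) fun y _ hy hyx hyp => key y hy hyx hyp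

lemma IsMin.no_two_chord_path (h : IsMin G z q P L) {v x p p' : Fin n}
    (hv : (L v).card = 2) (hvx : G.Adj v x) (hx : z x ∉ closure (faceOn G z q univ))
    (hp : p ∈ P) (hp' : p' ∈ P) (hpp : p ≠ p') (hxp : G.Adj x p) (hxp' : G.Adj x p') :
    False := by
  have hch := h.chain
  have hnd := h.nodup
  have hlen := h.length_le
  have hxP : x ∉ P := fun hxP => hx (h.path_mem x hxP)
  match P, h, hch, hnd, hlen, hp, hp', hxP with
  | [a], _, _, _, _, hp, hp', _ =>
    simp at hp hp'
    exact hpp (hp.trans hp'.symm)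
  | [a, b], h, hch, _, _, hp, hp', _ =>
    simp only [List.isChain_cons_cons, List.isChain_singleton, and_true] at hch
    have hx' : G.Adj x a ∧ G.Adj x b := by
      simp at hp hp'
      grind
    exact h.no_two_chord_path_aux hv hvx hx (p := a) (p' := b) (by simp) (by simp) hch.1 hx'.1
      hx'.2 (Or.inl ⟨_, rfl⟩)
  | [a, b, c], h, hch, hnd, _, hp, hp', hxP =>
    simp only [List.isChain_cons_cons, List.isChain_singleton, and_true] at hch
    simp at hp hp' hnd hxP
    have hac : ¬ (G.Adj x a ∧ G.Adj x c) := fun hx' =>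
      h.no_four a b c x hch.1.1 hch.2.1 hx'.2.symm hx'.1 hnd.1.2 (fun hbx => hxP.2.1 hbx.symm)
    have hx' : (G.Adj x a ∧ G.Adj x b) ∨ (G.Adj x c ∧ G.Adj x b) := by
      grind
    rcases hx' with hx' | hx'
    · exact h.no_two_chord_path_aux hv hvx hx (p := a) (p' := b) (by simp) (by simp) hch.1.1 hx'.1
        hx'.2 (Or.inl ⟨_, rfl⟩)
    · exact h.no_two_chord_path_aux hv hvx hx (p := c) (p' := b) (by simp) (by simp) hch.2.1.symm
        hx'.1 hx'.2 (Or.inr ⟨[a, b], rfl⟩)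
  | _ :: _ :: _ :: _ :: _, _, _, _, hlen, _, _, _ => simp at hlen; omega

lemma drawOn_mono_adj {V : Type} {G H : SimpleGraph V} (hH : H ≤ G) (z : V → ℂ) (S : Set V) :
    drawOn H z S ⊆ drawOn G z S := by
  rintro p (⟨a, ha, rfl⟩ | ⟨a, ha, b, hb, hab, hp⟩)
  · exact Or.inl ⟨a, ha, rfl⟩
  · exact Or.inr ⟨a, ha, b, hb, hH hab, hp⟩

lemma faceOn_anti_adj {V : Type} {G H : SimpleGraph V} (hH : H ≤ G) (z : V → ℂ) (q : ℂ)
    (S : Set V) : faceOn G z q univ ⊆ faceOn H z q S :=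
  connectedComponentIn_mono _ (compl_subset_compl.2
    ((drawOn_mono_adj hH z S).trans (drawOn_mono G z (subset_univ S))))

/-- Deleting a vertex of the boundary of a face puts its neighbours on the boundary. -/
lemma mem_closure_faceOn_of_adj {V : Type} [Finite V] {G H : SimpleGraph V} {z : V → ℂ} {q : ℂ}
    (hD : IsDrawing G z) (hH : H ≤ G) {v x : V} (hvx : G.Adj v x)
    (hv : z v ∈ closure (faceOn G z q univ)) : z x ∈ closure (faceOn H z q {v}ᶜ) := by
  obtain ⟨r, hr, hball⟩ := exists_ball hD v
  have hvF : z v ∈ faceOn H z q {v}ᶜ := by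
    obtain ⟨p, hp, hpr⟩ := Metric.mem_closure_iff.1 hv r hr
    have : Metric.ball (z v) r ⊆ faceOn H z q {v}ᶜ := by
      refine subset_faceOn (convex_ball _ _).isPreconnected
        ⟨p, by rwa [Metric.mem_ball, dist_comm], faceOn_anti_adj hH z q _ hp⟩ ?_
      exact fun p hp h => hball p hp (drawOn_mono_adj hH z _ h)
    exact this (Metric.mem_ball_self hr)
  have hne : z v ≠ z x := hD.inj.ne hvx.ne
  have hsub : (fun t : ℝ => sidePt (z v) (z x) t 0) '' Ico 0 1 ⊆ faceOn H z q {v}ᶜ := by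
    refine subset_faceOn (isPreconnected_sidePt_image _ _ isPreconnected_Ico)
      ⟨z v, ⟨0, by simp, sidePt_zero _ _⟩, hvF⟩ ?_
    rintro _ ⟨t, ht, rfl⟩ hmem
    have hseg := sidePt_mem_segment (a := z v) (b := z x) ⟨ht.1, ht.2.le⟩
    have hnx := sidePt_ne_right hne ht.2.ne
    rcases drawOn_mono_adj hH z _ hmem with ⟨a, ha, h⟩ | ⟨a, ha, b, hb, hab, hp⟩
    · by_cases hax : a = x
      · subst hax
        exact hnx h.symm
      · exact hD.off hvx ha hax (h ▸ hseg)
    · have hva : v ≠ a := fun h => ha h.symm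
      have hvb : v ≠ b := fun h => hb h.symm
      have := hD.meet hvx hab (by simp [hva, hvb]) ⟨hseg, hp⟩
      rcases this with ⟨h1 | h1, h2⟩
      · rcases h2 with h2 | h2
        · exact hva (hD.inj (h1.symm.trans h2))
        · exact hvb (hD.inj (h1.symm.trans h2))
      · exact hnx h1
  have hx : sidePt (z v) (z x) 1 0 ∈ closure ((fun t : ℝ => sidePt (z v) (z x) t 0) '' Ico 0 1) := by
    have hc : Continuous fun t : ℝ => sidePt (z v) (z x) t 0 := by
      unfold sidePt; fun_prop
    refine image_closure_subset_closure_image hc ⟨1, ?_, rfl⟩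
    rw [closure_Ico (by norm_num)]
    simp
  rw [sidePt_one] at hx
  exact closure_mono hsub hx

/-- If the colour `c` of a two-colour vertex `v` on the outer face is not shared with the outer
neighbours of `v`, then colouring `v` by `c` and deleting it contradicts minimality. -/
theorem IsMin.color_mem (h : IsMin G z q P L) {v a b : Fin n} (hv : (L v).card = 2)
    (hva : G.Adj v a) (hvb : G.Adj v b) (hab : a ≠ b)
    (ha : segment ℝ (z v) (z a) ⊆ closure (faceOn G z q univ))
    (hb : segment ℝ (z v) (z b) ⊆ closure (faceOn G z q univ)) {c : ℕ} (hc : c ∈ L v)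
    (hca : c ∉ L a) (hcb : c ∉ L b) : False := by
  classical
  have hvP := h.notMem_path hv
  have hvF := h.mem_face hv
  set X : Set (Fin n) := {x | G.Adj v x ∧ c ∈ L x} with hX
  have hXF : ∀ x ∈ X, z x ∉ closure (faceOn G z q univ) := by
    rintro x ⟨hvx, hcx⟩
    exact h.no_chord hv hva hvb hab ha hb hvx (fun e => hca (e ▸ hcx)) (fun e => hcb (e ▸ hcx))
  have hX3 : ∀ x ∈ X, 3 ≤ (L x).card := fun x hx => h.inner x (hXF x hx)
  have hXP : ∀ x ∈ P, x ∉ X := fun x hx hxX => hXF x hxX (h.path_mem x hx)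
  let H : SimpleGraph (Fin n) :=
    { Adj := fun u w => G.Adj u w ∧ ¬ (u ∈ X ∧ w ∈ X)
      symm := ⟨fun u w huw => ⟨huw.1.symm, fun hc => huw.2 hc.symm⟩⟩
      loopless := ⟨fun u hu => hu.1.ne rfl⟩ }
  have hH : H ≤ G := fun u w huw => huw.1
  set L' : Fin n → Finset ℕ := fun x => if x ∈ X then (L x).erase c else L x with hL'
  have hLX : ∀ x ∈ X, L' x = (L x).erase c := fun x hx => by simp [hL', hx]
  have hLn : ∀ x, x ∉ X → L' x = L x := fun x hx => by simp [hL', hx]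
  have hLs : ∀ x, L' x ⊆ L x := by
    intro x
    by_cases hx : x ∈ X
    · rw [hLX x hx]; exact Finset.erase_subset _ _
    · rw [hLn x hx]
  have hcX : ∀ x ∈ X, (L' x).card + 1 = (L x).card := by
    intro x hx
    rw [hLX x hx]
    exact Finset.card_erase_add_one hx.2
  have hmix : ∀ u w, u ∈ X → w ∉ X → w ≠ v → G.Adj u w → (L w).card ≠ 2 := by
    intro u w hu hw hwv huw hw2
    exact h.no_two_chord_two hv hw2 hu.1 huw hwv.symm (hXF u hu)
  have hcl : closure (faceOn G z q univ) ⊆ closure (faceOn H z q {v}ᶜ) :=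
    closure_mono (faceOn_anti_adj hH z q _)
  have hadjP : ∀ u ∈ P, ∀ w, G.Adj u w → H.Adj u w := fun u hu w huw =>
    ⟨huw, fun hc => hXP u hu hc.1⟩
  obtain ⟨φ, h1, h2⟩ := h.minimal H hH {v}ᶜ
    (by rw [Ne, compl_univ_iff]; exact (singleton_nonempty v).ne_empty) P
    (fun w hw e => hvP (e ▸ hw)) h.nodup h.length_le (fun w hw => hcl (h.path_mem w hw))
    (by
      refine List.IsChain.imp_of_mem_imp ?_ h.chain
      intro u w hu hw huw
      exact ⟨hadjP u hu w huw.1, huw.2.trans hcl⟩) L'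
    (fun u _ w _ huw => (Finset.card_le_card (Finset.inter_subset_inter (hLs u) (hLs w))).trans
      (h.inter u w huw.1))
    (fun w _ _ hz => by
      have hw : w ∉ X := fun hw => hz (mem_closure_faceOn_of_adj h.drawing hH hw.1 hvF)
      rw [hLn w hw]
      exact h.inner w fun h' => hz (hcl h'))
    (fun w _ hwP => by
      by_cases hw : w ∈ X
      · have := hX3 w hw
        have := hcX w hw
        omega
      · rw [hLn w hw]
        exact h.outer w hwP)
    (fun w hw => by rw [hLn w (hXP w hw)]; exact h.path w hw)
    (fun u hu w hw huw hu2 hw2 => by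
      by_cases huX : u ∈ X <;> by_cases hwX : w ∈ X
      · exact huw.2 ⟨huX, hwX⟩
      · rw [hLn w hwX] at hw2
        exact hmix u w huX hwX hw huw.1 hw2
      · rw [hLn u huX] at hu2
        exact hmix w u hwX huX hu huw.1.symm hu2
      · rw [hLn u huX] at hu2
        rw [hLn w hwX] at hw2
        exact h.no_adj u w huw.1 hu2 hw2)
    (by
      obtain ⟨ψ, p1, p2⟩ := h.path_col
      exact ⟨ψ, fun w hw => by rw [hLn w (hXP w hw)]; exact p1 w hw,
        fun u hu w hw huw => p2 u hu w hw huw.1⟩)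
    (fun x _ hx2 u hu w hw huw hxu hxw => by
      by_cases hx : x ∈ X
      · exact h.no_two_chord_path hv hx.1 (hXF x hx) hu hw huw hxu.1 hxw.1
      · rw [hLn x hx] at hx2
        exact h.no_two x hx2 u hu w hw huw hxu.1 hxw.1)
  have hφv : ∀ w, G.Adj v w → φ w ≠ c := by
    intro w hvw hwc
    have hw := h1 w hvw.ne'
    rw [hwc] at hw
    by_cases hwX : w ∈ X
    · rw [hLX w hwX] at hw
      exact Finset.notMem_erase c _ hw
    · rw [hLn w hwX] at hw
      exact hwX ⟨hvw, hw⟩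
  refine h.not_col ⟨Function.update φ v c, fun w => ?_, fun u w huw => ?_⟩
  · by_cases hw : w = v
    · subst hw
      rwa [Function.update_self]
    · rw [Function.update_of_ne hw]
      exact hLs w (h1 w hw)
  · by_cases hu : u = v
    · subst hu
      rw [Function.update_self, Function.update_of_ne huw.ne']
      exact (hφv w huw).symm
    by_cases hw : w = v
    · subst hw
      rw [Function.update_self, Function.update_of_ne hu]
      exact hφv u huw.symm
    rw [Function.update_of_ne hu, Function.update_of_ne hw]
    by_cases hXX : u ∈ X ∧ w ∈ X
    · intro he
      have hu1 := h1 u hu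
      have hw1 := h1 w hw
      rw [hLX u hXX.1, Finset.mem_erase] at hu1
      rw [hLX w hXX.2, Finset.mem_erase, ← he] at hw1
      exact hu1.1 (Finset.card_le_one.1 (h.inter u w huw) _
        (Finset.mem_inter.2 ⟨hu1.2, hw1.2⟩) _ (Finset.mem_inter.2 ⟨hXX.1.2, hXX.2.2⟩))
    · exact h2 u hu w hw ⟨huw, hXX⟩

end Reduce

/-- **Claim 9 in the proof of Theorem 6.** In a minimum counterexample to Theorem 6, if
`v0 v1 v2` is a path on the outer cycle with `|L(v1)| = 2`, then
`L(v1) ∩ L(v0) ≠ L(v1) ∩ L(v2)`. -/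
theorem min_cex_C4free_L2_neighbors_differ (C : Cfg4) (hC : C.MinCounterexample) :
    ∀ v0 v1 v2 : Fin C.n, C.IsOuterPath v0 v1 v2 → (C.L v1).card = 2 →
      C.L v1 ∩ C.L v0 ≠ C.L v1 ∩ C.L v2 := by
  intro v0 v1 v2 ⟨hne, ⟨h01, hs0⟩, h12, hs2⟩ hcard heq
  obtain ⟨⟨q, hq, hF⟩, -⟩ := hC.1.2.1
  have h := hC.isMin hq hF
  rw [hF, C.E.seg_subset_closure_face hq] at hs0 hs2
  rw [segment_symm] at hs0
  obtain ⟨c, hc, hc0⟩ : ∃ c ∈ C.L v1, c ∉ C.L v0 := by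
    by_contra! hsub
    have := h.inter v1 v0 h01.symm
    rw [Finset.inter_eq_left.2 hsub] at this
    omega
  refine h.color_mem hcard h01.symm h12 hne hs0 hs2 hc hc0 fun hc2 => hc0 ?_
  have hmem : c ∈ C.L v1 ∩ C.L v2 := Finset.mem_inter.2 ⟨hc, hc2⟩
  rw [← heq] at hmem
  exact (Finset.mem_inter.1 hmem).2

end ChoosSep
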